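/- arXiv:1901.02234 — 2 statements merged into one kernel-verified Lean document; each statement's English description precedes it below -/
import Mathlib

section
/- For every integer k ≥ 1, p_k(n) ~ b_k · exp(c_k n^{1/(k+1)}) / n^{(3k+1)/(2k+2)} as n → ∞, where a_k := (k^{-1} ζ(1+1/k) Γ(1+1/k))^{k/(k+1)}, b_k := a_k / ((2π)^{(k+1)/2} √(1+1/k)), and c_k := (k+1) a_k. -/
open Real Filter Topology

/-- Number of partitions of `n` into `k`-th powers. -/
noncomputable def pk (k n : ℕ) : ℕ :=
  Nat.card {p : n.Partition // ∀ a ∈ p.parts, ∃ m : ℕ, 0 < m ∧ a = m ^ k}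

/-- `a_k = (k⁻¹ ζ(1 + 1/k) Γ(1 + 1/k))^{k/(k+1)}`. -/
noncomputable def ak (k : ℕ) : ℝ :=
  ((k : ℝ)⁻¹ * (riemannZeta (1 + 1 / (k : ℂ))).re * Real.Gamma (1 + 1 / (k : ℝ))) ^
    ((k : ℝ) / (k + 1))

/-- `b_k = a_k / ((2π)^{(k+1)/2} √(1 + 1/k))`. -/
noncomputable def bk (k : ℕ) : ℝ :=
  ak k / ((2 * π) ^ (((k : ℝ) + 1) / 2) * Real.sqrt (1 + 1 / (k : ℝ)))

/-- `c_k = (k+1) a_k`. -/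
noncomputable def ck (k : ℕ) : ℝ := (k + 1) * ak k

section GeneratingFunction

open PowerSeries PowerSeries.WithPiTopology

lemma coeff_tsum_X_pow_mul {a : ℕ} (ha : 0 < a) (n : ℕ) :
    coeff n (∑' j : ℕ, (X : ℂ⟦X⟧) ^ (a * j)) = if a ∣ n then 1 else 0 := by
  have hs : Summable fun j : ℕ => (X : ℂ⟦X⟧) ^ (a * j) := by
    simp_rw [pow_mul]
    exact summable_pow_of_constantCoeff_eq_zero (by simp [ha.ne'])
  have h := (hs.hasSum.map (coeff n) (continuous_coeff ℂ n)).tsum_eq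
  rw [← h]
  simp only [Function.comp_def, coeff_X_pow]
  split_ifs with hd
  · obtain ⟨c, rfl⟩ := hd
    rw [tsum_eq_single c]
    · simp
    · intro j hj
      rw [if_neg]
      intro h
      exact hj (Nat.eq_of_mul_eq_mul_left ha h).symm
  · rw [tsum_congr (g := fun _ => (0 : ℂ)), tsum_zero]
    intro j
    rw [if_neg]
    rintro rfl
    exact hd (dvd_mul_right _ _)

lemma hasSum_coeff_tsum_X_pow_mul {a : ℕ} (ha : 0 < a) {z : ℂ} (hz : ‖z‖ < 1) :
    HasSum (fun n => coeff n (∑' j : ℕ, (X : ℂ⟦X⟧) ^ (a * j)) * z ^ n) (1 - z ^ a)⁻¹ := by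
  have hinj : Function.Injective fun j : ℕ => a * j := fun i j h => Nat.eq_of_mul_eq_mul_left ha h
  rw [← hinj.hasSum_iff]
  · have : ‖z ^ a‖ < 1 := by
      rw [norm_pow]; exact pow_lt_one₀ (norm_nonneg _) hz ha.ne'
    convert! hasSum_geometric_of_norm_lt_one this using 2 with j
    simp only [Function.comp_apply]
    rw [coeff_tsum_X_pow_mul ha, if_pos (dvd_mul_right _ _), one_mul, pow_mul]
  · intro n hn
    rw [coeff_tsum_X_pow_mul ha, if_neg, zero_mul]
    rintro ⟨c, rfl⟩
    exact hn ⟨c, rfl⟩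

lemma hasSum_coeff_mul {P Q : ℂ⟦X⟧} {z v w : ℂ} (hP : HasSum (fun n => coeff n P * z ^ n) v)
    (hQ : HasSum (fun n => coeff n Q * z ^ n) w) :
    HasSum (fun n => coeff n (P * Q) * z ^ n) (v * w) := by
  have hP' := hP.summable.norm
  have hQ' := hQ.summable.norm
  have key := tsum_mul_tsum_eq_tsum_sum_antidiagonal_of_summable_norm hP' hQ'
  have hs := (summable_norm_sum_mul_antidiagonal_of_summable_norm hP' hQ').of_norm
  rw [hP.tsum_eq, hQ.tsum_eq] at key
  rw [key]
  convert! hs.hasSum using 2 with n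
  rw [coeff_mul, Finset.sum_mul]
  refine Finset.sum_congr rfl fun p hp => ?_
  rw [← Finset.HasAntidiagonal.mem_antidiagonal.1 hp, pow_add]
  ring

/-- The generating series of partitions into `k`-th powers of numbers at most `M`. -/
noncomputable def powerPartSeries (k M : ℕ) : ℂ⟦X⟧ :=
  ∏ m ∈ Finset.range M, ∑' j : ℕ, X ^ ((m + 1) ^ k * j)

lemma hasSum_coeff_powerPartSeries (k M : ℕ) {z : ℂ} (hz : ‖z‖ < 1) :
    HasSum (fun n => coeff n (powerPartSeries k M) * z ^ n)
      (∏ m ∈ Finset.range M, (1 - z ^ ((m + 1) ^ k))⁻¹) := by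
  induction M with
  | zero =>
    simp only [powerPartSeries, Finset.range_zero, Finset.prod_empty, coeff_one]
    convert! hasSum_ite_eq (0 : ℕ) (1 : ℂ) using 2 with n
    split_ifs with h <;> simp [h]
  | succ M ih =>
    rw [powerPartSeries, Finset.prod_range_succ, Finset.prod_range_succ]
    exact hasSum_coeff_mul ih (hasSum_coeff_tsum_X_pow_mul (by positivity) hz)

open Classical in
lemma tendsto_coeff_powerPartSeries {k : ℕ} (hk : 1 ≤ k) (n : ℕ) :
    Tendsto (fun M => coeff n (powerPartSeries k M)) atTop (𝓝 (pk k n : ℂ)) := by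
  let p : ℕ → Prop := fun a => ∃ m : ℕ, 0 < m ∧ a = m ^ k
  have h := Nat.Partition.hasProd_powerSeriesMk_card_restricted ℂ p
  let e : ℕ → ℕ := fun m => (m + 1) ^ k - 1
  have hsucc (m : ℕ) : e m + 1 = (m + 1) ^ k := Nat.sub_add_cancel (Nat.one_le_pow _ _ (by simp))
  have hinj : Function.Injective e := by
    intro a b hab
    have : (a + 1) ^ k = (b + 1) ^ k := by rw [← hsucc, ← hsucc, hab]
    simpa using Nat.pow_left_injective (by lia) this
  rw [← hinj.hasProd_iff] at h
  · have h2 := (h.tendsto_prod_nat)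
    have h3 := ((continuous_coeff ℂ n).tendsto _).comp h2
    have hcard : (pk k n : ℂ) = coeff n (PowerSeries.mk fun n ↦
        ((Nat.Partition.restricted n p).card : ℂ)) := by
      rw [coeff_mk, pk, Nat.card_eq_fintype_card, Fintype.card_subtype]
      rfl
    rw [hcard]
    convert! h3 using 2 with M
    simp only [powerPartSeries, Function.comp_def]
    congr 1
    refine Finset.prod_congr rfl fun m _ => ?_
    rw [if_pos ⟨m + 1, by lia, hsucc m⟩, hsucc]
  · intro i hi
    rw [if_neg]
    rintro ⟨m, hm, him⟩
    refine hi ⟨m - 1, ?_⟩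
    have := hsucc (m - 1)
    rw [Nat.sub_add_cancel hm, ← him] at this
    lia

end GeneratingFunction

lemma integral_exp_int_mul_I (j : ℤ) :
    ∫ t in (-π)..π, Complex.exp (j * t * Complex.I) = if j = 0 then 2 * π else 0 := by
  split_ifs with h
  · simp [h]; ring
  · have : (j : ℂ) * Complex.I ≠ 0 := by simp [h]
    have h2 : ∀ t : ℝ, Complex.exp (j * t * Complex.I) = Complex.exp (j * Complex.I * t) := by
      intro t; ring_nf
    simp_rw [h2]
    rw [integral_exp_mul_complex this]
    have : Complex.exp (j * Complex.I * (π : ℝ)) = Complex.exp (j * Complex.I * (-π : ℝ)) := by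
      rw [Complex.exp_eq_exp_iff_exists_int]
      exact ⟨j, by push_cast; ring⟩
    rw [this]; simp

lemma integral_hasSum_mul_exp {c : ℕ → ℂ} {f : ℂ → ℂ} {r : ℝ} (hr : 0 ≤ r) (n : ℕ)
    (hc : ∀ z : ℂ, ‖z‖ = r → HasSum (fun j => c j * z ^ j) (f z)) :
    ∫ t in (-π)..π, f (r * Complex.exp (-t * Complex.I)) * Complex.exp (n * t * Complex.I) =
      2 * π * (c n * r ^ n) := by
  have hnorm (t : ℝ) : ‖(r * Complex.exp (-t * Complex.I) : ℂ)‖ = r := by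
    rw [norm_mul, ← Complex.ofReal_neg, Complex.norm_exp_ofReal_mul_I]; simp [abs_of_nonneg hr]
  have hs : Summable fun j => ‖c j‖ * r ^ j := by
    have := (hc r (by simp [abs_of_nonneg hr])).summable.norm
    simpa [abs_of_nonneg hr] using this
  have h := intervalIntegral.hasSum_integral_of_dominated_convergence (μ := MeasureTheory.volume)
    (a := -π) (b := π) (ι := ℕ)
    (F := fun j t => c j * r ^ j * Complex.exp (((n : ℤ) - (j : ℤ) : ℤ) * t * Complex.I))
    (f := fun t => f (r * Complex.exp (-t * Complex.I)) * Complex.exp (n * t * Complex.I))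
    (fun j _ => ‖c j‖ * r ^ j)
    (fun j => Continuous.aestronglyMeasurable (by fun_prop))
    (fun j => MeasureTheory.ae_of_all _ fun t _ => by
      rw [norm_mul]
      have : ‖Complex.exp (((n : ℤ) - (j : ℤ) : ℤ) * t * Complex.I)‖ = 1 := by
        have := Complex.norm_exp_ofReal_mul_I (((n : ℤ) - (j : ℤ) : ℤ) * t)
        push_cast at this ⊢; exact this
      rw [this]; simp [abs_of_nonneg hr])
    (MeasureTheory.ae_of_all _ fun t _ => hs) (by simp)
    (MeasureTheory.ae_of_all _ fun t _ => by
      convert! (hc _ (hnorm t)).mul_right (Complex.exp (n * t * Complex.I)) using 2 with j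
      rw [mul_pow, ← Complex.exp_nat_mul, mul_assoc, mul_assoc (c j), mul_assoc (_ ^ j),
        ← Complex.exp_add]
      push_cast; ring_nf)
  rw [← h.tsum_eq, tsum_eq_single n]
  · rw [intervalIntegral.integral_const_mul, integral_exp_int_mul_I]; simp; ring
  · intro j hj
    rw [intervalIntegral.integral_const_mul, integral_exp_int_mul_I, if_neg (by lia)]; simp

/-- The terms `((j + 1) y) ^ r exp (-(j + 1) y) / (j + 1)` of `lambertSum`. -/
noncomputable def lambertTerm (r : ℕ) (y : ℝ) (j : ℕ) : ℝ :=
  ((j + 1) * y) ^ r * exp (-((j + 1) * y)) / (j + 1)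

/-- The sum of `((j + 1) y) ^ r exp (-(j + 1) y) / (j + 1)` over `j`. It equals
`(-y d/dy) ^ r (-log (1 - exp (-y)))` up to lower-order terms. -/
noncomputable def lambertSum (r : ℕ) (y : ℝ) : ℝ := ∑' j, lambertTerm r y j

lemma lambertTerm_nonneg (r : ℕ) {y : ℝ} (hy : 0 ≤ y) (j : ℕ) : 0 ≤ lambertTerm r y j := by
  unfold lambertTerm; positivity

lemma lambertSum_nonneg (r : ℕ) {y : ℝ} (hy : 0 ≤ y) : 0 ≤ lambertSum r y :=
  tsum_nonneg fun j => lambertTerm_nonneg r hy j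

lemma pow_mul_exp_neg_le (r : ℕ) {x : ℝ} (hx : 0 ≤ x) :
    x ^ r * exp (-x) ≤ r.factorial * 2 ^ r * exp (-(x / 2)) := by
  have h := Real.pow_div_factorial_le_exp (x := x / 2) (by positivity) r
  rw [div_le_iff₀ (by positivity), div_pow, div_le_iff₀ (by positivity)] at h
  calc x ^ r * exp (-x) ≤ exp (x / 2) * r.factorial * 2 ^ r * exp (-x) := by gcongr
    _ = r.factorial * 2 ^ r * (exp (x / 2) * exp (-x)) := by ring
    _ = _ := by rw [← Real.exp_add]; ring_nf

lemma lambertTerm_le (r : ℕ) {y : ℝ} (hy : 0 ≤ y) (j : ℕ) :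
    lambertTerm r y j ≤ r.factorial * 2 ^ r * exp (-(y / 2)) ^ (j + 1) := by
  unfold lambertTerm
  have h := pow_mul_exp_neg_le r (x := (j + 1) * y) (by positivity)
  have h1 : exp (-((j + 1) * y / 2)) = exp (-(y / 2)) ^ (j + 1) := by
    rw [← Real.exp_nat_mul]; push_cast; ring_nf
  rw [h1] at h
  refine (div_le_self (by positivity) ?_).trans h
  linarith [(Nat.cast_nonneg j : (0 : ℝ) ≤ j)]

lemma summable_exp_neg_pow_succ {y : ℝ} (hy : 0 < y) (C : ℝ) :
    Summable fun j : ℕ => C * exp (-y) ^ (j + 1) := by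
  refine Summable.mul_left _ ?_
  exact (summable_nat_add_iff 1).2 (summable_geometric_of_lt_one (exp_pos _).le
    (by rw [Real.exp_lt_one_iff]; linarith))

lemma tsum_exp_neg_pow_succ {y : ℝ} (hy : 0 < y) :
    ∑' j : ℕ, exp (-y) ^ (j + 1) = 1 / (exp y - 1) := by
  have h1 : exp (-y) < 1 := by rw [Real.exp_lt_one_iff]; linarith
  have h2 : 1 < exp y := by rwa [Real.one_lt_exp_iff]
  simp_rw [pow_succ]
  rw [tsum_mul_right, tsum_geometric_of_lt_one (exp_pos _).le h1, Real.exp_neg]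
  have : exp y - 1 ≠ 0 := by linarith
  field_simp

lemma summable_lambertTerm (r : ℕ) {y : ℝ} (hy : 0 < y) : Summable (lambertTerm r y) :=
  Summable.of_nonneg_of_le (lambertTerm_nonneg r hy.le) (lambertTerm_le r hy.le)
    (summable_exp_neg_pow_succ (half_pos hy) _)

lemma continuousOn_lambertSum (r : ℕ) : ContinuousOn (lambertSum r) (Set.Ioi 0) := by
  intro a ha
  have ha : 0 < a := ha
  refine ContinuousAt.continuousWithinAt ?_
  refine ContinuousOn.continuousAt (s := Set.Ici (a / 2)) ?_ (Ici_mem_nhds (by linarith))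
  refine continuousOn_tsum (u := fun j => r.factorial * 2 ^ r * exp (-(a / 2 / 2)) ^ (j + 1)) ?_
    (summable_exp_neg_pow_succ (by linarith) _) ?_
  · intro j
    unfold lambertTerm
    exact Continuous.continuousOn (by fun_prop)
  · intro j y hy
    have hy : a / 2 ≤ y := hy
    rw [Real.norm_of_nonneg (lambertTerm_nonneg r (by linarith) j)]
    refine (lambertTerm_le r (by linarith) j).trans ?_
    gcongr

lemma div_exp_sub_one_le {z : ℝ} (hz : 0 < z) : z / (exp z - 1) ≤ 6 / (1 + z ^ 2) := by
  have h := Real.sum_le_exp_of_nonneg hz.le 4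
  simp only [Finset.sum_range_succ, Finset.sum_range_zero, Nat.factorial] at h
  norm_num at h
  have h1 : 0 < exp z - 1 := by linarith [Real.add_one_lt_exp hz.ne']
  rw [div_le_div_iff₀ h1 (by positivity)]
  nlinarith [pow_pos hz 2, pow_pos hz 3]

lemma lambertSum_succ_le (r : ℕ) {y : ℝ} (hy : 0 < y) :
    lambertSum (r + 1) y ≤ r.factorial * 2 ^ r * 48 / (1 + y ^ 2) := by
  have hterm (j : ℕ) : lambertTerm (r + 1) y j ≤
      r.factorial * 2 ^ r * y * exp (-(y / 2)) ^ (j + 1) := by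
    have h := pow_mul_exp_neg_le r (x := (j + 1) * y) (by positivity)
    have h1 : exp (-((j + 1) * y / 2)) = exp (-(y / 2)) ^ (j + 1) := by
      rw [← Real.exp_nat_mul]; push_cast; ring_nf
    rw [h1] at h
    have : lambertTerm (r + 1) y j = y * (((j + 1) * y) ^ r * exp (-((j + 1) * y))) := by
      unfold lambertTerm
      field_simp
      ring
    rw [this]
    calc _ ≤ y * (r.factorial * 2 ^ r * exp (-(y / 2)) ^ (j + 1)) := by gcongr
      _ = _ := by ring
  have h1 := (summable_lambertTerm (r + 1) hy).tsum_le_tsum hterm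
    (summable_exp_neg_pow_succ (half_pos hy) _)
  rw [tsum_mul_left, tsum_exp_neg_pow_succ (half_pos hy)] at h1
  have h2 := div_exp_sub_one_le (half_pos hy)
  have h3 : 6 / (1 + (y / 2) ^ 2) ≤ 24 / (1 + y ^ 2) := by
    rw [div_le_div_iff₀ (by positivity) (by positivity)]
    nlinarith [sq_nonneg y]
  calc lambertSum (r + 1) y ≤ _ := h1
    _ = r.factorial * 2 ^ r * 2 * ((y / 2) / (exp (y / 2) - 1)) := by ring
    _ ≤ r.factorial * 2 ^ r * 2 * (24 / (1 + y ^ 2)) :=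
      mul_le_mul_of_nonneg_left (h2.trans h3) (by positivity)
    _ = _ := by ring

lemma lambertSum_zero {y : ℝ} (hy : 0 < y) : lambertSum 0 y = -log (1 - exp (-y)) := by
  have h1 : |exp (-y)| < 1 := by
    rw [abs_of_pos (exp_pos _), Real.exp_lt_one_iff]; linarith
  rw [← (Real.hasSum_pow_div_log_of_abs_lt_one h1).tsum_eq, lambertSum]
  refine tsum_congr fun j => ?_
  rw [lambertTerm, ← Real.exp_nat_mul]
  push_cast; ring_nf

lemma lambertSum_one {y : ℝ} (hy : 0 < y) : lambertSum 1 y = y / (exp y - 1) := by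
  rw [div_eq_mul_one_div, ← tsum_exp_neg_pow_succ hy, ← tsum_mul_left, lambertSum]
  refine tsum_congr fun j => ?_
  rw [lambertTerm, ← Real.exp_nat_mul]
  push_cast
  field_simp

lemma antitoneOn_lambertSum_zero : AntitoneOn (lambertSum 0) (Set.Ioi 0) := by
  intro a ha b hb hab
  refine (summable_lambertTerm 0 hb).tsum_le_tsum (fun j => ?_) (summable_lambertTerm 0 ha)
  simp only [lambertTerm, pow_zero, one_mul]
  gcongr

lemma antitoneOn_lambertSum_one : AntitoneOn (lambertSum 1) (Set.Ioi 0) := by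
  intro a ha b hb hab
  have ha : 0 < a := ha
  have hb : 0 < b := hb
  rw [lambertSum_one ha, lambertSum_one hb]
  have h1 : 0 < exp a - 1 := by linarith [Real.add_one_lt_exp ha.ne']
  have h2 : 0 < exp b - 1 := by linarith [Real.add_one_lt_exp hb.ne']
  rw [div_le_div_iff₀ h2 h1]
  rcases hab.eq_or_lt with rfl | hlt
  · exact le_rfl
  have := convexOn_exp.secant_mono (a := 0) (x := a) (y := b) trivial trivial trivial
    ha.ne' hb.ne' hab
  rw [Real.exp_zero, sub_zero, sub_zero, div_le_div_iff₀ ha hb] at this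
  linarith

lemma lambertSum_one_le_one {y : ℝ} (hy : 0 < y) : lambertSum 1 y ≤ 1 := by
  rw [lambertSum_one hy]
  have h1 := Real.add_one_lt_exp hy.ne'
  rw [div_le_one (by linarith)]
  linarith

section Integral

open MeasureTheory

lemma integral_lambertTerm_pow {k : ℕ} (hk : 1 ≤ k) (r j : ℕ) :
    ∫ x in Set.Ioi (0 : ℝ), lambertTerm r (x ^ k) j =
      (1 / (j + 1 : ℝ) ^ (1 + 1 / (k : ℝ))) * (Gamma (r + 1 / k) / k) := by
  have hk0 : (0 : ℝ) < k := by positivity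
  have hj : (0 : ℝ) < j + 1 := by positivity
  have h := integral_rpow_mul_exp_neg_mul_rpow (p := k) (q := (k * r : ℕ)) (b := j + 1)
    hk0 (by have : (0 : ℝ) ≤ (k * r : ℕ) := Nat.cast_nonneg _
            linarith) hj
  have h2 : ∀ x : ℝ, lambertTerm r (x ^ k) j =
      ((j + 1 : ℝ) ^ r / (j + 1)) * (x ^ ((k * r : ℕ) : ℝ) * exp (-(j + 1) * x ^ (k : ℝ))) := by
    intro x
    rw [lambertTerm, rpow_natCast, rpow_natCast, mul_pow, ← pow_mul]
    ring_nf
  simp_rw [h2]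
  rw [integral_const_mul, h]
  have e1 : (((k * r : ℕ) : ℝ) + 1) / k = r + 1 / k := by push_cast; field_simp
  have e2 : -(((k * r : ℕ) : ℝ) + 1) / k = -r + -(1 / k) := by push_cast; field_simp; ring
  rw [e1, e2, rpow_add hj, rpow_add hj, rpow_one, rpow_neg hj.le, rpow_neg hj.le, rpow_natCast]
  field_simp

lemma integrableOn_lambertTerm_pow {k : ℕ} (hk : 1 ≤ k) (r j : ℕ) :
    IntegrableOn (fun x : ℝ => lambertTerm r (x ^ k) j) (Set.Ioi 0) := by
  have hk0 : (0 : ℝ) < k := by positivity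
  refine not_imp_comm.1 integral_undef ?_
  rw [integral_lambertTerm_pow hk]
  have : 0 < Gamma (r + 1 / (k : ℝ)) := Gamma_pos_of_pos (by positivity)
  positivity

lemma summable_zeta_terms {k : ℕ} (hk : 1 ≤ k) :
    Summable fun j : ℕ => 1 / (j + 1 : ℝ) ^ (1 + 1 / (k : ℝ)) := by
  have hk0 : (0 : ℝ) < k := by positivity
  have := (summable_nat_add_iff 1).2 (Real.summable_one_div_nat_rpow (p := 1 + 1 / (k : ℝ)).2
    (by have : 0 < 1 / (k : ℝ) := by positivity
        linarith))
  simpa using this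

lemma tsum_zeta_terms {k : ℕ} (hk : 1 ≤ k) :
    ∑' j : ℕ, 1 / (j + 1 : ℝ) ^ (1 + 1 / (k : ℝ)) = (riemannZeta (1 + 1 / (k : ℂ))).re := by
  have hk0 : (0 : ℝ) < k := by positivity
  have e : (1 + 1 / (k : ℂ)) = ((1 + 1 / (k : ℝ) : ℝ) : ℂ) := by push_cast; rfl
  have h1 : 0 < 1 / (k : ℝ) := by positivity
  rw [zeta_eq_tsum_one_div_nat_add_one_cpow (by rw [e, Complex.ofReal_re]; linarith)]
  rw [← Complex.ofReal_re (∑' j : ℕ, 1 / (j + 1 : ℝ) ^ (1 + 1 / (k : ℝ))), Complex.ofReal_tsum]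
  congr 2
  ext j
  rw [e]
  have := Complex.ofReal_cpow (x := j + 1) (by positivity) (1 + 1 / (k : ℝ))
  push_cast at this ⊢
  rw [this]

lemma hasSum_integral_lambertTerm_pow {k : ℕ} (hk : 1 ≤ k) (r : ℕ) :
    HasSum (fun j => ∫ x in Set.Ioi (0 : ℝ), lambertTerm r (x ^ k) j)
      (∫ x in Set.Ioi (0 : ℝ), lambertSum r (x ^ k)) := by
  refine hasSum_integral_of_summable_integral_norm (integrableOn_lambertTerm_pow hk r) ?_
  have : ∀ j, ∫ x in Set.Ioi (0 : ℝ), ‖lambertTerm r (x ^ k) j‖ =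
      ∫ x in Set.Ioi (0 : ℝ), lambertTerm r (x ^ k) j := fun j =>
    setIntegral_congr_fun measurableSet_Ioi fun x hx =>
      Real.norm_of_nonneg (lambertTerm_nonneg r (pow_nonneg (le_of_lt hx) _) j)
  simp_rw [this, integral_lambertTerm_pow hk]
  exact (summable_zeta_terms hk).mul_right _

lemma integral_lambertSum_pow {k : ℕ} (hk : 1 ≤ k) (r : ℕ) :
    ∫ x in Set.Ioi (0 : ℝ), lambertSum r (x ^ k) =
      (riemannZeta (1 + 1 / (k : ℂ))).re * (Gamma (r + 1 / k) / k) := by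
  rw [← (hasSum_integral_lambertTerm_pow hk r).tsum_eq]
  simp_rw [integral_lambertTerm_pow hk]
  rw [tsum_mul_right, tsum_zeta_terms hk]

lemma riemannZeta_re_pos {k : ℕ} (hk : 1 ≤ k) : 0 < (riemannZeta (1 + 1 / (k : ℂ))).re := by
  rw [← tsum_zeta_terms hk]
  exact (summable_zeta_terms hk).tsum_pos (fun j => by positivity) 0 (by simp)

lemma integrableOn_lambertSum_pow {k : ℕ} (hk : 1 ≤ k) (r : ℕ) :
    IntegrableOn (fun x : ℝ => lambertSum r (x ^ k)) (Set.Ioi 0) := by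
  have hk0 : (0 : ℝ) < k := by positivity
  refine not_imp_comm.1 integral_undef ?_
  rw [integral_lambertSum_pow hk]
  have : 0 < Gamma (r + 1 / (k : ℝ)) := Gamma_pos_of_pos (by positivity)
  have := riemannZeta_re_pos hk
  positivity

end Integral

lemma norm_exp_neg_I_sub_quadratic_le (x : ℝ) :
    ‖Complex.exp (-(x * Complex.I)) - 1 + x * Complex.I + x ^ 2 / 2‖ ≤ 4 * |x| ^ 3 := by
  have hn : ‖(-(x * Complex.I) : ℂ)‖ = |x| := by simp
  have he : ‖Complex.exp (-(x * Complex.I))‖ = 1 := by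
    have := Complex.norm_exp_ofReal_mul_I (-x)
    rwa [Complex.ofReal_neg, neg_mul] at this
  rcases le_or_gt |x| 1 with h | h
  · have h1 := Complex.exp_bound (x := -(x * Complex.I)) (by rwa [hn]) (n := 3) (by norm_num)
    rw [hn] at h1
    simp only [Finset.sum_range_succ, Finset.sum_range_zero, Nat.factorial] at h1
    have e : Complex.exp (-(x * Complex.I)) - 1 + x * Complex.I + x ^ 2 / 2 =
        Complex.exp (-(x * Complex.I)) - (0 + (-(x * Complex.I)) ^ 0 / ((1 : ℕ) : ℂ) +
          (-(x * Complex.I)) ^ 1 / (((0 + 1) * 1 : ℕ) : ℂ) +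
          (-(x * Complex.I)) ^ 2 / (((1 + 1) * ((0 + 1) * 1) : ℕ) : ℂ)) := by
      push_cast
      have := Complex.I_sq
      linear_combination (x ^ 2 / 2 : ℂ) * this
    rw [e]
    refine h1.trans ?_
    norm_num
    have := pow_nonneg (abs_nonneg x) 3
    linarith
  · have h2 : ‖(x ^ 2 / 2 : ℂ)‖ = |x| ^ 2 / 2 := by simp
    have h3 : ‖(x * Complex.I : ℂ)‖ = |x| := by simp
    calc _ ≤ ‖Complex.exp (-(x * Complex.I))‖ + ‖(1 : ℂ)‖ + ‖(x * Complex.I : ℂ)‖ +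
          ‖(x ^ 2 / 2 : ℂ)‖ := by
          refine (norm_add_le _ _).trans (add_le_add_left ((norm_add_le _ _).trans
            (add_le_add_left (norm_sub_le _ _) _)) _)
      _ = 1 + 1 + |x| + |x| ^ 2 / 2 := by rw [he, h2, h3, norm_one]
      _ ≤ 4 * |x| ^ 3 := by nlinarith [mul_pos (sub_pos.2 h) (sub_pos.2 h), sq_nonneg |x|]

/-- The terms of `lambertPhase`. -/
noncomputable def lambertPhaseTerm (y τ : ℝ) (j : ℕ) : ℂ :=
  (exp (-((j + 1) * y)) / (j + 1) : ℝ) *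
    (Complex.exp (-((((j + 1) * y * τ : ℝ) : ℂ) * Complex.I)) - 1)

/-- A logarithm of `(1 - exp (-y)) / (1 - exp (-y (1 + i τ)))`. -/
noncomputable def lambertPhase (y τ : ℝ) : ℂ := ∑' j, lambertPhaseTerm y τ j

lemma norm_lambertPhaseTerm_le {y : ℝ} (hy : 0 ≤ y) (τ : ℝ) (j : ℕ) :
    ‖lambertPhaseTerm y τ j‖ ≤ |τ| * lambertTerm 1 y j := by
  rw [lambertPhaseTerm, norm_mul]
  have h := Real.norm_exp_I_mul_ofReal_sub_one_le (x := -((j + 1) * y * τ))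
  have e : Complex.I * ((-((j + 1) * y * τ) : ℝ) : ℂ) =
      -((((j + 1) * y * τ : ℝ) : ℂ) * Complex.I) := by push_cast; ring
  rw [e] at h
  rw [Complex.norm_real, Real.norm_of_nonneg (by positivity)]
  have e2 : ‖-((j + 1) * y * τ)‖ = (j + 1) * y * |τ| := by
    rw [norm_neg, Real.norm_eq_abs, abs_mul, abs_of_nonneg (by positivity)]
  rw [e2] at h
  calc _ ≤ exp (-((j + 1) * y)) / (j + 1) * ((j + 1) * y * |τ|) := by gcongr
    _ = _ := by rw [lambertTerm]; ring

lemma summable_lambertPhaseTerm {y : ℝ} (hy : 0 < y) (τ : ℝ) :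
    Summable (lambertPhaseTerm y τ) :=
  Summable.of_norm_bounded ((summable_lambertTerm 1 hy).mul_left _)
    (norm_lambertPhaseTerm_le hy.le τ)

lemma norm_lambertPhase_le {y : ℝ} (hy : 0 < y) (τ : ℝ) :
    ‖lambertPhase y τ‖ ≤ |τ| * lambertSum 1 y := by
  rw [lambertSum, ← tsum_mul_left]
  exact tsum_of_norm_bounded ((summable_lambertTerm 1 hy).mul_left _).hasSum
    (norm_lambertPhaseTerm_le hy.le τ)

lemma norm_lambertPhase_sub_quadratic_le {y : ℝ} (hy : 0 < y) (τ : ℝ) :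
    ‖lambertPhase y τ + τ * lambertSum 1 y * Complex.I + τ ^ 2 / 2 * lambertSum 2 y‖ ≤
      4 * |τ| ^ 3 * lambertSum 3 y := by
  have h1 := (summable_lambertTerm 1 hy).hasSum.mapL Complex.ofRealCLM
  have h2 := (summable_lambertTerm 2 hy).hasSum.mapL Complex.ofRealCLM
  have h3 := ((summable_lambertPhaseTerm hy τ).hasSum.add (h1.mul_left (τ * Complex.I))).add
    (h2.mul_left (τ ^ 2 / 2 : ℂ))
  have e : lambertPhase y τ + τ * lambertSum 1 y * Complex.I + τ ^ 2 / 2 * lambertSum 2 y =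
    lambertPhase y τ + τ * Complex.I * Complex.ofRealCLM (lambertSum 1 y) +
      τ ^ 2 / 2 * Complex.ofRealCLM (lambertSum 2 y) := by
    simp only [Complex.ofRealCLM_apply]; ring
  rw [e, lambertPhase, lambertSum, lambertSum, ← h3.tsum_eq, lambertSum, ← tsum_mul_left]
  refine tsum_of_norm_bounded ((summable_lambertTerm 3 hy).mul_left _).hasSum fun j => ?_
  have hj : (j + 1 : ℂ) ≠ 0 := by exact_mod_cast Nat.succ_ne_zero j
  have e2 : lambertPhaseTerm y τ j + τ * Complex.I * Complex.ofRealCLM (lambertTerm 1 y j) +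
      τ ^ 2 / 2 * Complex.ofRealCLM (lambertTerm 2 y j) =
      (exp (-((j + 1) * y)) / (j + 1) : ℝ) *
        (Complex.exp (-((((j + 1) * y * τ : ℝ) : ℂ) * Complex.I)) - 1 +
          ((((j + 1) * y * τ : ℝ) : ℂ) * Complex.I) + (((j + 1) * y * τ : ℝ) : ℂ) ^ 2 / 2) := by
    simp only [lambertPhaseTerm, lambertTerm, Complex.ofRealCLM_apply]
    push_cast
    field_simp
  rw [e2, norm_mul, Complex.norm_real, Real.norm_of_nonneg (by positivity)]
  have h4 := norm_exp_neg_I_sub_quadratic_le ((j + 1) * y * τ)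
  calc _ ≤ exp (-((j + 1) * y)) / (j + 1) * (4 * |(j + 1) * y * τ| ^ 3) := by gcongr
    _ = _ := by
      rw [abs_mul, abs_of_nonneg (by positivity : 0 ≤ (j + 1) * y), lambertTerm]; ring

lemma re_lambertPhaseTerm (y τ : ℝ) (j : ℕ) : (lambertPhaseTerm y τ j).re =
    -(exp (-((j + 1) * y)) / (j + 1) * (1 - cos ((j + 1) * y * τ))) := by
  have h := Complex.exp_ofReal_mul_I_re (-((j + 1) * y * τ))
  rw [Complex.ofReal_neg, neg_mul, cos_neg] at h
  rw [lambertPhaseTerm, Complex.re_ofReal_mul, Complex.sub_re, h, Complex.one_re]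
  ring

lemma re_lambertPhase_le {y : ℝ} (hy : 0 < y) (τ : ℝ) :
    (lambertPhase y τ).re ≤ -(exp (-y) * (1 - cos (y * τ))) := by
  have hs := Complex.hasSum_re (summable_lambertPhaseTerm hy τ).hasSum
  have h := hs.neg
  have hnn (j : ℕ) : 0 ≤ -(lambertPhaseTerm y τ j).re := by
    rw [re_lambertPhaseTerm, neg_neg]
    have := cos_le_one ((j + 1) * y * τ)
    exact mul_nonneg (by positivity) (by linarith)
  have h0 := le_hasSum h 0 (fun j _ => hnn j)
  rw [re_lambertPhaseTerm, neg_neg] at h0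
  simp only [Nat.cast_zero, zero_add, one_mul, div_one] at h0
  rw [lambertPhase]
  linarith

lemma re_lambertPhase_nonpos {y : ℝ} (hy : 0 < y) (τ : ℝ) : (lambertPhase y τ).re ≤ 0 := by
  refine (re_lambertPhase_le hy τ).trans ?_
  have := cos_le_one (y * τ)
  have := mul_nonneg (exp_pos (-y)).le (sub_nonneg.2 this)
  linarith

lemma inv_one_sub_exp_eq_mul_exp_lambertPhase {y : ℝ} (hy : 0 < y) (τ : ℝ) :
    (1 - Complex.exp (-y - ((y * τ : ℝ) : ℂ) * Complex.I))⁻¹ =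
      ((exp (lambertSum 0 y) : ℝ) : ℂ) * Complex.exp (lambertPhase y τ) := by
  set z := Complex.exp (-y - ((y * τ : ℝ) : ℂ) * Complex.I) with hz
  have hz1 : ‖z‖ < 1 := by
    rw [hz, Complex.norm_exp]
    simp [hy]
  have h1 := Complex.hasSum_taylorSeries_neg_log' hz1
  have h2 := ((summable_lambertTerm 0 hy).hasSum.mapL Complex.ofRealCLM).add
    (summable_lambertPhaseTerm hy τ).hasSum
  have e (j : ℕ) : Complex.ofRealCLM (lambertTerm 0 y j) + lambertPhaseTerm y τ j =
      z ^ (j + 1) / (j + 1) := by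
    have : z ^ (j + 1) = ((exp (-((j + 1) * y)) : ℝ) : ℂ) *
        Complex.exp (-((((j + 1) * y * τ : ℝ) : ℂ) * Complex.I)) := by
      rw [hz, ← Complex.exp_nat_mul, Complex.ofReal_exp, ← Complex.exp_add]
      push_cast; ring_nf
    rw [this]
    simp only [lambertPhaseTerm, lambertTerm, Complex.ofRealCLM_apply]
    push_cast; ring
  simp_rw [e] at h2
  have h3 : (lambertSum 0 y : ℂ) + lambertPhase y τ = -Complex.log (1 - z) :=
    h2.unique h1
  have hne : 1 - z ≠ 0 := by
    intro h
    rw [← sub_eq_zero.1 h] at hz1; simp at hz1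
  rw [Complex.ofReal_exp, ← Complex.exp_add, h3, Complex.exp_neg, Complex.exp_log hne]

theorem mem_Ioc_div_iff_ceil_eq {l x : ℝ} (hl : 0 < l) (m : ℕ) :
    x ∈ Set.Ioc (m / l) ((m + 1) / l) ↔ ⌈l * x⌉₊ = m + 1 := by
  rw [Nat.ceil_eq_iff (by omega), Set.mem_Ioc, div_lt_iff₀ hl, le_div_iff₀ hl, mul_comm x l]
  simp

theorem iUnion_Ioc_div {l : ℝ} (hl : 0 < l) :
    ⋃ m : ℕ, Set.Ioc ((m : ℝ) / l) ((m + 1) / l) = Set.Ioi 0 := by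
  ext x
  simp only [Set.mem_iUnion, mem_Ioc_div_iff_ceil_eq hl, Set.mem_Ioi]
  constructor
  · rintro ⟨m, hm⟩
    have : 0 < ⌈l * x⌉₊ := by omega
    rw [Nat.ceil_pos] at this
    exact pos_of_mul_pos_right this hl.le
  · intro hx
    have : 0 < ⌈l * x⌉₊ := Nat.ceil_pos.2 (by positivity)
    exact ⟨⌈l * x⌉₊ - 1, by omega⟩

theorem hasSum_integral_Ioc_div {l : ℝ} (hl : 0 < l) {F : ℝ → ℝ}
    (hF : MeasureTheory.IntegrableOn F (Set.Ioi 0)) :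
    HasSum (fun m : ℕ => ∫ x in Set.Ioc ((m : ℝ) / l) ((m + 1) / l), F x)
      (∫ x in Set.Ioi 0, F x) := by
  rw [← iUnion_Ioc_div hl] at hF ⊢
  refine MeasureTheory.hasSum_integral_iUnion (fun m => measurableSet_Ioc) ?_ hF
  intro i j hij
  refine Set.disjoint_left.2 fun x hx hx' => hij ?_
  rw [mem_Ioc_div_iff_ceil_eq hl] at hx hx'
  omega

theorem le_ceil_mul_div {l : ℝ} (hl : 0 < l) (x : ℝ) : x ≤ ⌈l * x⌉₊ / l := by
  rw [le_div_iff₀ hl, mul_comm]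
  exact Nat.le_ceil _

theorem tendsto_ceil_mul_div {x : ℝ} (hx : 0 < x) :
    Tendsto (fun l : ℝ => (⌈l * x⌉₊ : ℝ) / l) atTop (𝓝 x) := by
  have h1 : Tendsto (fun l : ℝ => x + l⁻¹) atTop (𝓝 x) := by
    simpa using tendsto_inv_atTop_zero.const_add x
  refine tendsto_of_tendsto_of_tendsto_of_le_of_le' tendsto_const_nhds h1 ?_ ?_
  · filter_upwards [eventually_gt_atTop 0] with l hl using le_ceil_mul_div hl x
  · filter_upwards [eventually_gt_atTop 0] with l hl
    rw [div_le_iff₀ hl]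
    have := (Nat.ceil_lt_add_one (by positivity : 0 ≤ l * x)).le
    field_simp
    linarith

theorem measurable_comp_ceil_mul_div (g : ℝ → ℝ) (l : ℝ) :
    Measurable fun x : ℝ => g (⌈l * x⌉₊ / l) :=
  (measurable_from_top (f := fun m : ℕ => g (m / l))).comp
    (Nat.measurable_ceil.comp (measurable_const_mul l))

section RiemannSum

variable {g H : ℝ → ℝ}

theorem integrableOn_comp_ceil_mul_div (hH : AntitoneOn H (Set.Ioi 0))
    (hHi : MeasureTheory.IntegrableOn H (Set.Ioi 0)) (hb : ∀ x, 0 < x → |g x| ≤ H x)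
    {l : ℝ} (hl : 0 < l) :
    MeasureTheory.IntegrableOn (fun x : ℝ => g (⌈l * x⌉₊ / l)) (Set.Ioi 0) := by
  refine hHi.mono' (measurable_comp_ceil_mul_div g l).aestronglyMeasurable ?_
  refine (MeasureTheory.ae_restrict_iff' measurableSet_Ioi).2 (MeasureTheory.ae_of_all _ ?_)
  intro x hx
  have hx' : (0 : ℝ) < x := hx
  have h := le_ceil_mul_div hl x
  exact (hb _ (hx'.trans_le h)).trans (hH hx (hx'.trans_le h) h)

theorem integrableOn_of_abs_le (hg : ContinuousOn g (Set.Ioi 0))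
    (hHi : MeasureTheory.IntegrableOn H (Set.Ioi 0)) (hb : ∀ x, 0 < x → |g x| ≤ H x) :
    MeasureTheory.IntegrableOn g (Set.Ioi 0) :=
  hHi.mono' (hg.aestronglyMeasurable measurableSet_Ioi)
    ((MeasureTheory.ae_restrict_iff' measurableSet_Ioi).2 (MeasureTheory.ae_of_all _ hb))

theorem tendsto_integral_abs_comp_ceil_sub (hg : ContinuousOn g (Set.Ioi 0))
    (hH : AntitoneOn H (Set.Ioi 0))
    (hHi : MeasureTheory.IntegrableOn H (Set.Ioi 0)) (hb : ∀ x, 0 < x → |g x| ≤ H x) :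
    Tendsto (fun l : ℝ => ∫ x in Set.Ioi 0, |g (⌈l * x⌉₊ / l) - g x|) atTop (𝓝 0) := by
  suffices Tendsto (fun l : ℝ => ∫ x in Set.Ioi 0, |g (⌈l * x⌉₊ / l) - g x|) atTop
      (𝓝 (∫ x in Set.Ioi (0 : ℝ), (0 : ℝ))) by simpa using this
  refine MeasureTheory.tendsto_integral_filter_of_dominated_convergence (fun x => 2 * H x) ?_ ?_
    (hHi.const_mul 2) ?_
  · refine Eventually.of_forall fun l => ?_
    exact (((measurable_comp_ceil_mul_div g l).aestronglyMeasurable).sub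
      (hg.aestronglyMeasurable measurableSet_Ioi)).norm
  · filter_upwards [eventually_gt_atTop 0] with l hl
    refine (MeasureTheory.ae_restrict_iff' measurableSet_Ioi).2 (MeasureTheory.ae_of_all _ ?_)
    intro x hx
    have hx' : (0 : ℝ) < x := hx
    have h := le_ceil_mul_div hl x
    have h1 := (hb _ (hx'.trans_le h)).trans (hH hx (hx'.trans_le h) h)
    have h2 := hb x hx'
    rw [Real.norm_eq_abs, abs_abs]
    exact (abs_sub _ _).trans (by linarith)
  · refine (MeasureTheory.ae_restrict_iff' measurableSet_Ioi).2 (MeasureTheory.ae_of_all _ ?_)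
    intro x hx
    have h1 : Tendsto (fun l : ℝ => g (⌈l * x⌉₊ / l)) atTop (𝓝 (g x)) :=
      ((hg.continuousAt (Ioi_mem_nhds hx)).tendsto).comp (tendsto_ceil_mul_div hx)
    simpa using (h1.sub_const (g x)).abs

theorem hasSum_grid_integral (hH : AntitoneOn H (Set.Ioi 0))
    (hHi : MeasureTheory.IntegrableOn H (Set.Ioi 0)) (hb : ∀ x, 0 < x → |g x| ≤ H x)
    {l : ℝ} (hl : 0 < l) :
    HasSum (fun m : ℕ => l⁻¹ * g ((m + 1) / l)) (∫ x in Set.Ioi 0, g (⌈l * x⌉₊ / l)) := by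
  convert! hasSum_integral_Ioc_div hl (integrableOn_comp_ceil_mul_div hH hHi hb hl) using 2 with m
  have : ∫ x in Set.Ioc ((m : ℝ) / l) ((m + 1) / l), g (⌈l * x⌉₊ / l) =
      ∫ x in Set.Ioc ((m : ℝ) / l) ((m + 1) / l), g ((m + 1) / l) := by
    refine MeasureTheory.setIntegral_congr_fun measurableSet_Ioc fun x hx => ?_
    rw [mem_Ioc_div_iff_ceil_eq hl] at hx
    simp [hx]
  rw [this, MeasureTheory.setIntegral_const, smul_eq_mul, MeasureTheory.measureReal_def,
    Real.volume_Ioc, ENNReal.toReal_ofReal (by rw [← sub_div]; simp; positivity)]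
  congr 1
  field_simp
  ring

theorem summable_grid (hH : AntitoneOn H (Set.Ioi 0))
    (hHi : MeasureTheory.IntegrableOn H (Set.Ioi 0)) (hb : ∀ x, 0 < x → |g x| ≤ H x)
    {l : ℝ} (hl : 0 < l) : Summable (fun m : ℕ => g ((m + 1) / l)) :=
  (summable_mul_left_iff (inv_ne_zero hl.ne')).1 (hasSum_grid_integral hH hHi hb hl).summable

theorem tendsto_riemannSum (hg : ContinuousOn g (Set.Ioi 0)) (hH : AntitoneOn H (Set.Ioi 0))
    (hHi : MeasureTheory.IntegrableOn H (Set.Ioi 0)) (hb : ∀ x, 0 < x → |g x| ≤ H x) :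
    Tendsto (fun l : ℝ => l⁻¹ * ∑' m : ℕ, g ((m + 1) / l)) atTop
      (𝓝 (∫ x in Set.Ioi 0, g x)) := by
  rw [tendsto_iff_dist_tendsto_zero]
  refine squeeze_zero' (Eventually.of_forall fun _ => dist_nonneg) ?_
    (tendsto_integral_abs_comp_ceil_sub hg hH hHi hb)
  filter_upwards [eventually_gt_atTop 0] with l hl
  rw [← tsum_mul_left, (hasSum_grid_integral hH hHi hb hl).tsum_eq, Real.dist_eq,
    ← MeasureTheory.integral_sub (integrableOn_comp_ceil_mul_div hH hHi hb hl)
      (integrableOn_of_abs_le hg hHi hb)]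
  exact MeasureTheory.abs_integral_le_integral_abs

end RiemannSum

theorem trapezoid_eq {ψ g : ℝ → ℝ} {a b : ℝ} (hab : a < b) (hψ : ContinuousOn ψ (Set.Icc a b))
    (hd : ∀ x ∈ Set.Ioo a b, HasDerivAt ψ (g x) x)
    (hg : IntervalIntegrable g MeasureTheory.volume a b) (c : ℝ) :
    (b - a) * ((ψ a + ψ b) / 2) - ∫ x in a..b, ψ x =
      ∫ x in a..b, (x - (a + b) / 2) * (g x - c) := by
  have hψi : IntervalIntegrable ψ MeasureTheory.volume a b :=
    (hψ.mono (by rw [Set.uIcc_of_le hab.le])).intervalIntegrable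
  have hmi : IntervalIntegrable (fun x => (x - (a + b) / 2) * g x) MeasureTheory.volume a b :=
    hg.continuousOn_mul (by fun_prop)
  have h1 := intervalIntegral.integral_eq_sub_of_hasDerivAt_of_le
    (f := fun x => (x - (a + b) / 2) * ψ x) (f' := fun x => ψ x + (x - (a + b) / 2) * g x)
    hab.le (by fun_prop)
    (fun x hx => by
      have h := ((hasDerivAt_id' x).sub_const ((a + b) / 2)).mul (hd x hx)
      rw [one_mul] at h
      exact h) (hψi.add hmi)
  rw [intervalIntegral.integral_add hψi hmi] at h1
  have h2 : ∫ x in a..b, (x - (a + b) / 2) * (g x - c) =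
      (∫ x in a..b, (x - (a + b) / 2) * g x) - ∫ x in a..b, (x - (a + b) / 2) * c := by
    rw [← intervalIntegral.integral_sub hmi
      (Continuous.intervalIntegrable (by fun_prop) _ _)]
    simp only [mul_sub]
  have h3 : ∫ x in a..b, (x - (a + b) / 2) * c = 0 := by
    rw [intervalIntegral.integral_mul_const, intervalIntegral.integral_sub (by simp) (by simp)]
    simp
    left
    ring
  rw [h2, h3]
  linarith

theorem tendsto_tsum_sub_integral {ψ g H : ℝ → ℝ} (hψ : ContinuousOn ψ (Set.Ici 0))
    (hψ0 : ψ 0 = 0) (hd : ∀ x, 0 < x → HasDerivAt ψ (g x) x) (hg : ContinuousOn g (Set.Ioi 0))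
    (hH : AntitoneOn H (Set.Ioi 0)) (hHi : MeasureTheory.IntegrableOn H (Set.Ioi 0))
    (hb : ∀ x, 0 < x → |g x| ≤ H x) (hψi : MeasureTheory.IntegrableOn ψ (Set.Ioi 0))
    (hs : ∀ l : ℝ, 0 < l → Summable (fun m : ℕ => ψ ((m + 1) / l))) :
    Tendsto (fun l : ℝ => ∑' m : ℕ, ψ ((m + 1) / l) - l * ∫ x in Set.Ioi 0, ψ x) atTop (𝓝 0) := by
  have hgi := integrableOn_of_abs_le hg hHi hb
  have hlim := (tendsto_integral_abs_comp_ceil_sub hg hH hHi hb).const_mul (1 / 2)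
  rw [mul_zero] at hlim
  refine squeeze_zero_norm' ?_ hlim
  filter_upwards [eventually_gt_atTop 0] with l hl
  have h1 := (hs l hl).hasSum
  have h2 : HasSum (fun m : ℕ => ψ (m / l)) (∑' m : ℕ, ψ ((m + 1) / l)) := by
    have := (hasSum_nat_add_iff (f := fun m : ℕ => ψ (m / l)) (g := ∑' m : ℕ, ψ ((m + 1) / l)) 1).1
      (by simpa using h1)
    simpa [hψ0] using this
  have h3 := (hasSum_integral_Ioc_div hl hψi).mul_left l
  have h4 := ((h2.add h1).div_const 2).sub h3
  have h5 := (hasSum_integral_Ioc_div hl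
    ((integrableOn_comp_ceil_mul_div hH hHi hb hl).sub hgi).norm).mul_left (1 / 2)
  have h6 := tsum_of_norm_bounded h5 (f := fun m : ℕ =>
    (ψ (m / l) + ψ ((m + 1) / l)) / 2 - l * ∫ x in Set.Ioc ((m : ℝ) / l) ((m + 1) / l), ψ x) ?_
  · rw [h4.tsum_eq] at h6
    simpa using h6
  intro m
  have ha : 0 ≤ (m : ℝ) / l := by positivity
  have hab : (m : ℝ) / l < (m + 1) / l := by gcongr; linarith
  have hsub : Set.Ioc ((m : ℝ) / l) ((m + 1) / l) ⊆ Set.Ioi 0 := fun x hx => ha.trans_lt hx.1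
  have hgc : IntervalIntegrable g MeasureTheory.volume ((m : ℝ) / l) ((m + 1) / l) :=
    (intervalIntegrable_iff_integrableOn_Ioc_of_le hab.le).2 (hgi.mono_set hsub)
  have key := trapezoid_eq hab (hψ.mono fun x hx => ha.trans hx.1)
    (fun x hx => hd x (ha.trans_lt hx.1)) hgc (g ((m + 1) / l))
  have hw : ((m : ℝ) + 1) / l - m / l = l⁻¹ := by field_simp; ring
  rw [hw] at key
  have hD : (ψ (m / l) + ψ ((m + 1) / l)) / 2 -
      l * ∫ x in Set.Ioc ((m : ℝ) / l) ((m + 1) / l), ψ x =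
      l * ∫ x in ((m : ℝ) / l)..((m + 1) / l),
        (x - ((m : ℝ) / l + (m + 1) / l) / 2) * (g x - g ((m + 1) / l)) := by
    rw [← key, intervalIntegral.integral_of_le hab.le]
    field_simp
  rw [hD, norm_mul, Real.norm_of_nonneg hl.le]
  have hR : ∫ x in Set.Ioc ((m : ℝ) / l) ((m + 1) / l),
      ‖((fun x : ℝ => g (⌈l * x⌉₊ / l)) - g) x‖ =
      ∫ x in ((m : ℝ) / l)..((m + 1) / l), |g x - g ((m + 1) / l)| := by
    rw [intervalIntegral.integral_of_le hab.le]
    refine MeasureTheory.setIntegral_congr_fun measurableSet_Ioc fun x hx => ?_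
    rw [mem_Ioc_div_iff_ceil_eq hl] at hx
    simp [hx, abs_sub_comm]
  have hdi := hgc.sub (intervalIntegrable_const (c := g ((m + 1) / l)))
  have hle : ‖∫ x in ((m : ℝ) / l)..((m + 1) / l),
        (x - ((m : ℝ) / l + (m + 1) / l) / 2) * (g x - g ((m + 1) / l))‖ ≤
      ∫ x in ((m : ℝ) / l)..((m + 1) / l), (l⁻¹ / 2) * |g x - g ((m + 1) / l)| := by
    refine intervalIntegral.norm_integral_le_of_norm_le hab.le
      (MeasureTheory.ae_of_all _ fun x hx => ?_) (hdi.norm.const_mul _)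
    rw [norm_mul, Real.norm_eq_abs, Real.norm_eq_abs]
    gcongr
    rw [abs_le]
    constructor <;> linarith [hx.1, hx.2]
  have hR' : ∫ x in Set.Ioc ((m : ℝ) / l) ((m + 1) / l),
      ‖g (⌈l * x⌉₊ / l) - g x‖ =
      ∫ x in ((m : ℝ) / l)..((m + 1) / l), |g x - g ((m + 1) / l)| := hR
  rw [intervalIntegral.integral_const_mul, ← hR'] at hle
  calc _ ≤ l * _ := mul_le_mul_of_nonneg_left hle hl.le
    _ = _ := by
      simp only [Pi.sub_apply]
      field_simp

theorem tsum_grid_le {F : ℝ → ℝ} (hF : AntitoneOn F (Set.Ioi 0)) (h0 : ∀ x, 0 < x → 0 ≤ F x)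
    (hFi : MeasureTheory.IntegrableOn F (Set.Ioi 0)) {l : ℝ} (hl : 0 < l) :
    ∑' m : ℕ, F ((m + 1) / l) ≤ l * ∫ x in Set.Ioi 0, F x := by
  have hb : ∀ x, 0 < x → |F x| ≤ F x := fun x hx => (abs_of_nonneg (h0 x hx)).le
  have h := hasSum_grid_integral hF hFi hb hl
  have h1 := h.tsum_eq
  rw [tsum_mul_left] at h1
  have h2 : ∫ x in Set.Ioi 0, F (⌈l * x⌉₊ / l) ≤ ∫ x in Set.Ioi 0, F x := by
    refine MeasureTheory.setIntegral_mono_on (integrableOn_comp_ceil_mul_div hF hFi hb hl) hFi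
      measurableSet_Ioi fun x hx => ?_
    have h := le_ceil_mul_div hl x
    exact hF hx (lt_of_lt_of_le hx h) h
  rw [← h1, inv_mul_le_iff₀ hl] at h2
  exact h2

theorem le_tsum_grid {F : ℝ → ℝ} (hF : AntitoneOn F (Set.Ioi 0)) (h0 : ∀ x, 0 < x → 0 ≤ F x)
    (hF1 : ∀ x, 0 < x → F x ≤ 1)
    (hFi : MeasureTheory.IntegrableOn F (Set.Ioi 0)) {l : ℝ} (hl : 0 < l) :
    l * ∫ x in Set.Ioi 0, F x ≤ ∑' m : ℕ, F ((m + 1) / l) + 1 := by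
  have hb : ∀ x, 0 < x → |F x| ≤ F x := fun x hx => (abs_of_nonneg (h0 x hx)).le
  have h1 := (summable_grid hF hFi hb hl).hasSum
  have h2 : HasSum (fun m : ℕ => if m = 0 then 1 else F (m / l))
      (∑' m : ℕ, F ((m + 1) / l) + 1) := by
    have := (hasSum_nat_add_iff (f := fun m : ℕ => if m = 0 then 1 else F (m / l))
      (g := ∑' m : ℕ, F ((m + 1) / l)) 1).1 (by simpa using h1)
    simpa using this
  refine hasSum_le (fun m => ?_) ((hasSum_integral_Ioc_div hl hFi).mul_left l) h2
  have hsub : Set.Ioc ((m : ℝ) / l) ((m + 1) / l) ⊆ Set.Ioi 0 :=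
    fun x hx => lt_of_le_of_lt (by positivity) hx.1
  have hm : ∫ x in Set.Ioc ((m : ℝ) / l) ((m + 1) / l), F x ≤
      ∫ x in Set.Ioc ((m : ℝ) / l) ((m + 1) / l), if m = 0 then 1 else F (m / l) := by
    refine MeasureTheory.setIntegral_mono_on (hFi.mono_set hsub) (by simp)
      measurableSet_Ioc fun x hx => ?_
    split_ifs with h
    · exact hF1 x (hsub hx)
    · have : (0 : ℝ) < m / l := by
        have : 0 < m := by omega
        positivity
      exact hF this (hsub hx) hx.1.le
  rw [MeasureTheory.setIntegral_const, smul_eq_mul, MeasureTheory.measureReal_def,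
    Real.volume_Ioc, show ((m : ℝ) + 1) / l - m / l = l⁻¹ by field_simp; ring,
    ENNReal.toReal_ofReal (by positivity)] at hm
  calc _ ≤ l * _ := mul_le_mul_of_nonneg_left hm hl.le
    _ = _ := by field_simp

theorem antitoneOn_div_one_add_sq {K : ℝ} (hK : 0 ≤ K) :
    AntitoneOn (fun x : ℝ => K / (1 + x ^ 2)) (Set.Ioi 0) := by
  intro x hx y hy hxy
  have hx' : (0 : ℝ) < x := hx
  dsimp only
  gcongr

theorem integrable_div_one_add_sq (K : ℝ) :
    MeasureTheory.Integrable (fun x : ℝ => K / (1 + x ^ 2)) := by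
  simpa [div_eq_mul_inv] using integrable_inv_one_add_sq.const_mul K

theorem lambertSum_succ_pow_le {k : ℕ} (hk : 1 ≤ k) (r : ℕ) {x : ℝ} (hx : 0 < x) :
    |lambertSum (r + 1) (x ^ k)| ≤ (2 * (r.factorial * 2 ^ r * 48)) / (1 + x ^ 2) := by
  rw [abs_of_nonneg (lambertSum_nonneg _ (by positivity))]
  refine (lambertSum_succ_le r (pow_pos hx k)).trans ?_
  rw [div_le_div_iff₀ (by positivity) (by positivity)]
  have : 1 + x ^ 2 ≤ 2 * (1 + (x ^ k) ^ 2) := by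
    rcases le_total x 1 with h | h
    · have : x ^ 2 ≤ 1 := pow_le_one₀ hx.le h
      have : 0 ≤ (x ^ k) ^ 2 := by positivity
      linarith
    · have : x ≤ x ^ k := le_self_pow₀ h (by omega)
      have : x ^ 2 ≤ (x ^ k) ^ 2 := by gcongr
      nlinarith [sq_nonneg x]
  calc _ ≤ (r.factorial * 2 ^ r * 48 : ℝ) * (2 * (1 + (x ^ k) ^ 2)) := by gcongr
    _ = _ := by ring

theorem continuousOn_lambertSum_pow (k r : ℕ) :
    ContinuousOn (fun x : ℝ => lambertSum r (x ^ k)) (Set.Ioi 0) :=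
  (continuousOn_lambertSum r).comp (by fun_prop) fun _ hx => Set.mem_Ioi.2 (pow_pos hx k)

theorem antitoneOn_comp_pow {f : ℝ → ℝ} (hf : AntitoneOn f (Set.Ioi 0)) (k : ℕ) :
    AntitoneOn (fun x : ℝ => f (x ^ k)) (Set.Ioi 0) := by
  intro x hx y hy hxy
  exact hf (Set.mem_Ioi.2 (pow_pos hx k)) (Set.mem_Ioi.2 (pow_pos hy k)) (pow_le_pow_left₀ (le_of_lt hx) hxy k)

/-- The sum of `lambertSum r` over the points `((m + 1) / l) ^ k`. -/
noncomputable def gridSum (k r : ℕ) (l : ℝ) : ℝ :=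
  ∑' m : ℕ, lambertSum r (((m + 1) / l) ^ k)

theorem exists_lambertSum_pow_majorant {k : ℕ} (hk : 1 ≤ k) (r : ℕ) :
    ∃ H : ℝ → ℝ, AntitoneOn H (Set.Ioi 0) ∧ MeasureTheory.IntegrableOn H (Set.Ioi 0) ∧
      ∀ x, 0 < x → |lambertSum r (x ^ k)| ≤ H x := by
  cases r with
  | zero =>
    exact ⟨_, antitoneOn_comp_pow antitoneOn_lambertSum_zero k, integrableOn_lambertSum_pow hk 0,
      fun x hx => (abs_of_nonneg (lambertSum_nonneg _ (by positivity))).le⟩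
  | succ r =>
    exact ⟨_, antitoneOn_div_one_add_sq (by positivity),
      (integrable_div_one_add_sq _).integrableOn, fun x hx => lambertSum_succ_pow_le hk r hx⟩

theorem summable_gridSum {k : ℕ} (hk : 1 ≤ k) (r : ℕ) {l : ℝ} (hl : 0 < l) :
    Summable (fun m : ℕ => lambertSum r (((m + 1) / l) ^ k)) := by
  obtain ⟨H, h1, h2, h3⟩ := exists_lambertSum_pow_majorant hk r
  exact summable_grid (g := fun x => lambertSum r (x ^ k)) h1 h2 h3 hl

theorem tendsto_gridSum {k : ℕ} (hk : 1 ≤ k) (r : ℕ) :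
    Tendsto (fun l : ℝ => l⁻¹ * gridSum k r l) atTop
      (𝓝 (∫ x in Set.Ioi 0, lambertSum r (x ^ k))) := by
  obtain ⟨H, h1, h2, h3⟩ := exists_lambertSum_pow_majorant hk r
  exact tendsto_riemannSum (continuousOn_lambertSum_pow k r) h1 h2 h3

theorem abs_gridSum_one_sub_le {k : ℕ} (hk : 1 ≤ k) {l : ℝ} (hl : 0 < l) :
    |gridSum k 1 l - l * ∫ x in Set.Ioi 0, lambertSum 1 (x ^ k)| ≤ 1 := by
  have h0 : ∀ x : ℝ, 0 < x → 0 ≤ lambertSum 1 (x ^ k) :=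
    fun x hx => lambertSum_nonneg _ (by positivity)
  have ha := antitoneOn_comp_pow antitoneOn_lambertSum_one k
  have h1 := tsum_grid_le ha h0 (integrableOn_lambertSum_pow hk 1) hl
  have h2 := le_tsum_grid ha h0 (fun x hx => lambertSum_one_le_one (pow_pos hx k))
    (integrableOn_lambertSum_pow hk 1) hl
  rw [abs_le, gridSum]
  constructor <;> linarith

theorem hasSum_log_one_add_inv_sq {l : ℝ} (hl : 0 < l) :
    HasSum (fun m : ℕ => log (1 + ((((m : ℝ) + 1) / l) ^ 2)⁻¹))
      (log (sinh (π * l) / (π * l))) := by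
  have hπl : 0 < π * l := by positivity
  have h := Complex.tendsto_euler_sin_prod (l * Complex.I)
  have h2 : Tendsto (fun n : ℕ => π * l *
      ∏ j ∈ Finset.range n, (1 + ((((j : ℝ) + 1) / l) ^ 2)⁻¹)) atTop (𝓝 (sinh (π * l))) := by
    have h3 := (Complex.continuous_im.tendsto _).comp h
    have e1 : (Complex.sin (π * (l * Complex.I))).im = sinh (π * l) := by
      rw [← mul_assoc, Complex.sin_mul_I, ← Complex.ofReal_mul, ← Complex.ofReal_sinh,
        Complex.im_ofReal_mul, Complex.I_im, mul_one]
    rw [e1] at h3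
    refine h3.congr fun n => ?_
    have e2 : ∏ j ∈ Finset.range n, ((1 : ℂ) - (l * Complex.I) ^ 2 / ((j : ℂ) + 1) ^ 2) =
        ((∏ j ∈ Finset.range n, (1 + ((((j : ℝ) + 1) / l) ^ 2)⁻¹) : ℝ) : ℂ) := by
      push_cast
      refine Finset.prod_congr rfl fun j _ => ?_
      rw [mul_pow, Complex.I_sq, div_pow, inv_div]
      ring
    rw [Function.comp_apply, e2, show (π : ℂ) * (l * Complex.I) *
      ((∏ j ∈ Finset.range n, (1 + ((((j : ℝ) + 1) / l) ^ 2)⁻¹) : ℝ) : ℂ) =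
      ((π * l * ∏ j ∈ Finset.range n, (1 + ((((j : ℝ) + 1) / l) ^ 2)⁻¹) : ℝ) : ℂ) * Complex.I by
        push_cast; ring, Complex.im_ofReal_mul, Complex.I_im, mul_one]
  have hpos : ∀ j : ℕ, 0 < 1 + ((((j : ℝ) + 1) / l) ^ 2)⁻¹ := fun j => by positivity
  rw [hasSum_iff_tendsto_nat_of_nonneg]
  · have h3 := ((continuousAt_log (x := sinh (π * l) / (π * l)) (by
      have := sinh_pos_iff.2 hπl
      positivity)).tendsto).comp (h2.div_const (π * l))
    refine h3.congr fun n => ?_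
    rw [Function.comp_apply, mul_div_cancel_left₀ _ hπl.ne',
      log_prod (fun j _ => (hpos j).ne')]
  · intro m
    exact log_nonneg (by simp; positivity)

theorem log_sinh_div {x : ℝ} (hx : 0 < x) :
    log (sinh x / x) = x - log (2 * x) + log (1 - exp (-(2 * x))) := by
  have h1 : exp (-(2 * x)) < 1 := exp_lt_one_iff.2 (by linarith)
  have : sinh x / x = exp x * (1 - exp (-(2 * x))) / (2 * x) := by
    rw [sinh_eq, mul_sub, ← exp_add, show x + -(2 * x) = -x by ring]
    field_simp
  rw [this, log_div (by have := exp_pos x; nlinarith) (by positivity),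
    log_mul (exp_pos x).ne' (by linarith), log_exp]
  ring

/-- The continuous extension to `x = 0` of `lambertSum 0 (x ^ k) - (k / 2) * log (1 + x⁻²)`. -/
noncomputable def lambertRemainder (k : ℕ) (x : ℝ) : ℝ :=
  -log (dslope (fun y : ℝ => -exp (-y)) 0 (x ^ k)) - k / 2 * log (1 + x ^ 2)

theorem hasDerivAt_neg_exp_neg (x : ℝ) : HasDerivAt (fun y : ℝ => -exp (-y)) (exp (-x)) x := by
  have h := ((hasDerivAt_neg' x).exp).neg
  rw [mul_neg_one, neg_neg] at h
  exact h

theorem dslope_neg_exp_neg_of_ne {y : ℝ} (hy : y ≠ 0) :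
    dslope (fun y : ℝ => -exp (-y)) 0 y = (1 - exp (-y)) / y := by
  rw [dslope_of_ne _ hy, slope_def_field]
  simp
  ring

theorem dslope_neg_exp_neg_pos {y : ℝ} (hy : 0 ≤ y) : 0 < dslope (fun y : ℝ => -exp (-y)) 0 y := by
  rcases hy.eq_or_lt with rfl | hy
  · rw [dslope_same, (hasDerivAt_neg_exp_neg 0).deriv]
    simp
  · rw [dslope_neg_exp_neg_of_ne hy.ne']
    exact div_pos (by simp [hy]) hy

theorem continuousOn_lambertRemainder (k : ℕ) :
    ContinuousOn (lambertRemainder k) (Set.Ici 0) := by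
  have h1 : Continuous (dslope (fun y : ℝ => -exp (-y)) 0) := by
    rw [← continuousOn_univ, continuousOn_dslope univ_mem]
    exact ⟨by fun_prop, (hasDerivAt_neg_exp_neg 0).differentiableAt⟩
  refine ContinuousOn.sub (ContinuousOn.neg (ContinuousOn.log ?_ ?_)) ?_
  · exact (h1.comp (by fun_prop : Continuous fun x : ℝ => x ^ k)).continuousOn
  · intro x hx
    exact (dslope_neg_exp_neg_pos (pow_nonneg hx k)).ne'
  · refine (Continuous.mul continuous_const (Continuous.log (by fun_prop) ?_)).continuousOn
    intro x
    positivity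

theorem lambertRemainder_zero {k : ℕ} (hk : 1 ≤ k) : lambertRemainder k 0 = 0 := by
  have : (0 : ℝ) ^ k = 0 := zero_pow (by omega)
  rw [lambertRemainder, this, dslope_same, (hasDerivAt_neg_exp_neg 0).deriv]
  simp

theorem lambertRemainder_of_pos (k : ℕ) {x : ℝ} (hx : 0 < x) :
    lambertRemainder k x = lambertSum 0 (x ^ k) - k / 2 * log (1 + (x ^ 2)⁻¹) := by
  have hy : 0 < x ^ k := by positivity
  have h1 : exp (-(x ^ k)) < 1 := exp_lt_one_iff.2 (by linarith)
  rw [lambertRemainder, dslope_neg_exp_neg_of_ne hy.ne', lambertSum_zero hy,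
    log_div (by linarith) hy.ne', log_pow,
    show 1 + (x ^ 2)⁻¹ = (1 + x ^ 2) / x ^ 2 by field_simp; ring,
    log_div (by positivity) (by positivity), log_pow]
  push_cast
  ring

theorem hasDerivAt_lambertRemainder (k : ℕ) (hk : 1 ≤ k) {x : ℝ} (hx : 0 < x) :
    HasDerivAt (lambertRemainder k) (k / x * (1 / (1 + x ^ 2) - lambertSum 1 (x ^ k))) x := by
  have hy : 0 < x ^ k := by positivity
  have h1 : exp (-(x ^ k)) < 1 := exp_lt_one_iff.2 (by linarith)
  have hev : lambertRemainder k =ᶠ[𝓝 x]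
      fun x => -log (1 - exp (-(x ^ k))) - k / 2 * log (1 + (x ^ 2)⁻¹) := by
    filter_upwards [Ioi_mem_nhds hx] with z hz
    rw [lambertRemainder_of_pos k hz, lambertSum_zero (pow_pos hz k)]
  refine HasDerivAt.congr_of_eventuallyEq ?_ hev
  have e1 : HasDerivAt (fun x : ℝ => -log (1 - exp (-(x ^ k))))
      (-(-(exp (-(x ^ k)) * -(k * x ^ (k - 1))) / (1 - exp (-(x ^ k))))) x :=
    ((((hasDerivAt_pow k x).neg.exp).const_sub 1).log (by
      show 1 - exp (-(x ^ k)) ≠ 0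
      linarith)).neg
  have e2 : HasDerivAt (fun x : ℝ => k / 2 * log (1 + (x ^ 2)⁻¹))
      (k / 2 * ((-(2 * x) / (x ^ 2) ^ 2) / (1 + (x ^ 2)⁻¹))) x := by
    have := (((hasDerivAt_pow 2 x).inv (by positivity)).const_add 1).log
      (by show 1 + (x ^ 2)⁻¹ ≠ 0; positivity)
    simpa using this.const_mul ((k : ℝ) / 2)
  refine (e1.sub e2).congr_deriv ?_
  rw [lambertSum_one hy]
  have h3 : exp (x ^ k) - 1 ≠ 0 := by
    have : 1 < exp (x ^ k) := one_lt_exp_iff.2 hy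
    linarith
  have h4 : exp (-(x ^ k)) / (1 - exp (-(x ^ k))) = 1 / (exp (x ^ k) - 1) := by
    rw [div_eq_div_iff (by linarith) h3, mul_sub, ← exp_add]
    simp
  have h5 : x ^ k = x ^ (k - 1) * x := by
    rw [← pow_succ]
    congr 1
    omega
  calc _ = -(exp (-(x ^ k)) / (1 - exp (-(x ^ k))) * (k * x ^ (k - 1))) +
        k / (x * (1 + x ^ 2)) := by field_simp; ring
    _ = -(1 / (exp (x ^ k) - 1) * (k * x ^ (k - 1))) + k / (x * (1 + x ^ 2)) := by rw [h4]
    _ = -(k / x * ((x ^ (k - 1) * x) / (exp (x ^ k) - 1))) + k / (x * (1 + x ^ 2)) := by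
      field_simp
    _ = _ := by
      rw [← h5]
      field_simp
      ring

theorem exp_neg_le_lambertSum_one {y : ℝ} (hy : 0 < y) : exp (-y) ≤ lambertSum 1 y := by
  have h1 : 1 < exp y := one_lt_exp_iff.2 hy
  rw [lambertSum_one hy, le_div_iff₀ (by linarith), mul_sub, ← exp_add]
  have := add_one_le_exp (-y)
  simp
  linarith

theorem abs_deriv_lambertRemainder_le {k : ℕ} (hk : 1 ≤ k) {x : ℝ} (hx : 0 < x) :
    |k / x * (1 / (1 + x ^ 2) - lambertSum 1 (x ^ k))| ≤ 48 * k / (1 + x ^ 2) := by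
  have hy : 0 < x ^ k := by positivity
  rw [abs_mul, abs_of_nonneg (by positivity : (0 : ℝ) ≤ k / x)]
  have hk0 : (0 : ℝ) ≤ k := by positivity
  suffices |1 / (1 + x ^ 2) - lambertSum 1 (x ^ k)| ≤ x * (48 / (1 + x ^ 2)) by
    calc _ ≤ k / x * (x * (48 / (1 + x ^ 2))) := by gcongr
      _ = _ := by field_simp
  rcases le_total x 1 with h | h
  · have a1 : x ^ k ≤ x := pow_le_of_le_one hx.le h (by omega)
    have a2 := exp_neg_le_lambertSum_one hy
    have a3 := add_one_le_exp (-(x ^ k))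
    have a4 := lambertSum_one_le_one hy
    have a5 : 1 / (1 + x ^ 2) ≤ 1 := by
      rw [div_le_one (by positivity)]
      nlinarith
    have a6 : 1 - x ≤ 1 / (1 + x ^ 2) := by
      rw [le_div_iff₀ (by positivity)]
      nlinarith [pow_pos hx 3, pow_pos hx 2]
    have a7 : x * 1 ≤ x * (48 / (1 + x ^ 2)) := by
      gcongr
      rw [le_div_iff₀ (by positivity)]
      nlinarith
    refine (abs_le.2 ⟨?_, ?_⟩ : _ ≤ x * 1).trans a7 <;> linarith
  · have b1 := lambertSum_succ_le 0 hy
    have b2 : x ≤ x ^ k := le_self_pow₀ h (by omega)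
    have b3 : (48 : ℝ) / (1 + (x ^ k) ^ 2) ≤ 48 / (1 + x ^ 2) := by gcongr
    have b4 := lambertSum_nonneg 1 hy.le
    have b5 : 1 / (1 + x ^ 2) ≤ 48 / (1 + x ^ 2) := by gcongr; norm_num
    have b6 : 0 ≤ 1 / (1 + x ^ 2) := by positivity
    have b7 : 1 * (48 / (1 + x ^ 2)) ≤ x * (48 / (1 + x ^ 2)) := by gcongr
    simp at b1
    refine (abs_le.2 ⟨?_, ?_⟩ : _ ≤ 1 * (48 / (1 + x ^ 2))).trans b7 <;> linarith

theorem integrableOn_lambertRemainder {k : ℕ} (hk : 1 ≤ k) :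
    MeasureTheory.IntegrableOn (lambertRemainder k) (Set.Ioi 0) := by
  rw [← Set.Ioc_union_Ioi_eq_Ioi zero_le_one]
  refine MeasureTheory.IntegrableOn.union ?_ ?_
  · exact (((continuousOn_lambertRemainder k).mono Set.Icc_subset_Ici_self).integrableOn_Icc).mono_set
      Set.Ioc_subset_Icc_self
  · have hsub : Set.Ioi (1 : ℝ) ⊆ Set.Ioi 0 := Set.Ioi_subset_Ioi zero_le_one
    have h1 : MeasureTheory.IntegrableOn (fun x : ℝ => log (1 + (x ^ 2)⁻¹)) (Set.Ioi 1) := by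
      refine ((integrable_div_one_add_sq 2).integrableOn).mono' ?_ ?_
      · exact Measurable.aestronglyMeasurable (by fun_prop)
      · refine (MeasureTheory.ae_restrict_iff' measurableSet_Ioi).2 (MeasureTheory.ae_of_all _ ?_)
        intro x hx
        have hx' : (1 : ℝ) < x := hx
        have hp : 0 < (x ^ 2)⁻¹ := by positivity
        rw [Real.norm_of_nonneg (log_nonneg (by linarith))]
        refine (log_le_sub_one_of_pos (by positivity)).trans ?_
        rw [add_sub_cancel_left, inv_eq_one_div, div_le_div_iff₀ (by positivity) (by positivity)]
        nlinarith
    refine (((integrableOn_lambertSum_pow hk 0).mono_set hsub).sub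
      (h1.const_mul ((k : ℝ) / 2))).congr_fun (fun x hx => ?_) measurableSet_Ioi
    exact (lambertRemainder_of_pos k (hsub hx)).symm

theorem tendsto_gridSum_zero_sub {k : ℕ} (hk : 1 ≤ k) :
    Tendsto (fun l : ℝ => gridSum k 0 l - l * (∫ x in Set.Ioi 0, lambertSum 0 (x ^ k)) +
      k / 2 * log (2 * π * l)) atTop (𝓝 0) := by
  set I := ∫ x in Set.Ioi 0, lambertRemainder k x with hI
  set C := ∫ x in Set.Ioi 0, lambertSum 0 (x ^ k) with hC
  have hsum : ∀ l : ℝ, 0 < l → HasSum (fun m : ℕ => lambertRemainder k ((m + 1) / l))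
      (gridSum k 0 l - k / 2 * log (sinh (π * l) / (π * l))) := by
    intro l hl
    convert! (summable_gridSum hk 0 hl).hasSum.sub
      ((hasSum_log_one_add_inv_sq hl).mul_left ((k : ℝ) / 2)) using 2 with m
    exact lambertRemainder_of_pos k (by positivity)
  have hg : ContinuousOn (fun x : ℝ => k / x * (1 / (1 + x ^ 2) - lambertSum 1 (x ^ k)))
      (Set.Ioi 0) := by
    refine ContinuousOn.mul (ContinuousOn.div (by fun_prop) (by fun_prop) fun x hx => ne_of_gt hx)
      (ContinuousOn.sub (ContinuousOn.div (by fun_prop) (by fun_prop) fun x hx => by positivity)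
        (continuousOn_lambertSum_pow k 1))
  have h1 := tendsto_tsum_sub_integral (continuousOn_lambertRemainder k)
    (lambertRemainder_zero hk) (fun x hx => hasDerivAt_lambertRemainder k hk hx) hg
    (antitoneOn_div_one_add_sq (by positivity : (0 : ℝ) ≤ 48 * k))
    (integrable_div_one_add_sq _).integrableOn
    (fun x hx => abs_deriv_lambertRemainder_le hk hx) (integrableOn_lambertRemainder hk)
    (fun l hl => (hsum l hl).summable)
  rw [← hI] at h1
  have hexp : Tendsto (fun l : ℝ => log (1 - exp (-(2 * (π * l))))) atTop (𝓝 0) := by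
    have e1 : Tendsto (fun l : ℝ => 2 * (π * l)) atTop atTop :=
      (tendsto_id.const_mul_atTop pi_pos).const_mul_atTop two_pos
    have e2 := ((tendsto_exp_neg_atTop_nhds_zero.comp e1).const_sub 1)
    rw [sub_zero] at e2
    have e3 := ((continuousAt_log one_ne_zero).tendsto).comp e2
    rw [log_one] at e3
    exact e3
  have h2 : Tendsto (fun l : ℝ => gridSum k 0 l - l * (I + k / 2 * π) +
      k / 2 * log (2 * π * l)) atTop (𝓝 0) := by
    have := h1.add (hexp.const_mul ((k : ℝ) / 2))
    rw [mul_zero, add_zero] at this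
    refine this.congr' ?_
    filter_upwards [eventually_gt_atTop 0] with l hl
    rw [(hsum l hl).tsum_eq, log_sinh_div (by positivity), ← mul_assoc 2 π l]
    ring
  have h3 : I + k / 2 * π = C := by
    have hinv := tendsto_inv_atTop_zero (𝕜 := ℝ)
    have e1 := hinv.mul h2
    have e2 : Tendsto (fun l : ℝ => l⁻¹ * (k / 2 * log (2 * π * l))) atTop (𝓝 0) := by
      have f1 := Real.tendsto_pow_log_div_mul_add_atTop 1 0 1 one_ne_zero
      have f2 : Tendsto (fun l : ℝ => 2 * π * l) atTop atTop :=
        tendsto_id.const_mul_atTop (by positivity)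
      have f3 := (f1.comp f2).const_mul (k / 2 * (2 * π))
      rw [mul_zero] at f3
      refine f3.congr' ?_
      filter_upwards [eventually_gt_atTop 0] with l hl
      simp
      field_simp
    have e3 := ((tendsto_gridSum hk 0).sub e1).add e2
    rw [mul_zero, sub_zero, add_zero] at e3
    refine (tendsto_nhds_unique (tendsto_const_nhds.congr' ?_) e3)
    filter_upwards [eventually_gt_atTop 0] with l hl
    field_simp
    ring
  rw [h3] at h2
  exact h2

/-- The sum of `lambertPhase` over the points `((m + 1) / l) ^ k`. -/
noncomputable def gridPhase (k : ℕ) (l τ : ℝ) : ℂ :=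
  ∑' m : ℕ, lambertPhase (((m + 1) / l) ^ k) τ

theorem summable_norm_gridPhase {k : ℕ} (hk : 1 ≤ k) {l : ℝ} (hl : 0 < l) (τ : ℝ) :
    Summable (fun m : ℕ => ‖lambertPhase (((m + 1) / l) ^ k) τ‖) :=
  Summable.of_nonneg_of_le (fun _ => norm_nonneg _)
    (fun m => norm_lambertPhase_le (by positivity) τ) ((summable_gridSum hk 1 hl).mul_left |τ|)

theorem hasSum_gridPhase {k : ℕ} (hk : 1 ≤ k) {l : ℝ} (hl : 0 < l) (τ : ℝ) :
    HasSum (fun m : ℕ => lambertPhase (((m + 1) / l) ^ k) τ) (gridPhase k l τ) :=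
  (summable_norm_gridPhase hk hl τ).of_norm.hasSum

theorem measurable_exp_lambertPhase {y : ℝ} (hy : 0 < y) :
    Measurable (fun τ : ℝ => Complex.exp (lambertPhase y τ)) := by
  have : (fun τ : ℝ => Complex.exp (lambertPhase y τ)) = fun τ : ℝ =>
      ((exp (lambertSum 0 y) : ℝ) : ℂ)⁻¹ *
        (1 - Complex.exp (-y - ((y * τ : ℝ) : ℂ) * Complex.I))⁻¹ := by
    funext τ
    rw [inv_one_sub_exp_eq_mul_exp_lambertPhase hy, inv_mul_cancel_left₀]
    exact_mod_cast (exp_pos _).ne'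
  rw [this]
  fun_prop

theorem tendsto_prod_exp_lambertPhase {k : ℕ} (hk : 1 ≤ k) {l : ℝ} (hl : 0 < l) (τ : ℝ) :
    Tendsto (fun M => ∏ m ∈ Finset.range M, Complex.exp (lambertPhase (((m + 1) / l) ^ k) τ))
      atTop (𝓝 (Complex.exp (gridPhase k l τ))) := by
  simp_rw [← Complex.exp_sum]
  exact (Complex.continuous_exp.tendsto _).comp (hasSum_gridPhase hk hl τ).tendsto_sum_nat

theorem measurable_exp_gridPhase {k : ℕ} (hk : 1 ≤ k) {l : ℝ} (hl : 0 < l) :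
    Measurable (fun τ : ℝ => Complex.exp (gridPhase k l τ)) := by
  refine measurable_of_tendsto_metrizable (f := fun M τ =>
    ∏ m ∈ Finset.range M, Complex.exp (lambertPhase (((m + 1) / l) ^ k) τ)) ?_
    (tendsto_pi_nhds.2 fun τ => tendsto_prod_exp_lambertPhase hk hl τ)
  intro M
  exact Finset.measurable_fun_prod _ fun m _ => measurable_exp_lambertPhase (by positivity)

theorem norm_exp_lambertPhase_le_one {y : ℝ} (hy : 0 < y) (τ : ℝ) :
    ‖Complex.exp (lambertPhase y τ)‖ ≤ 1 := by
  rw [Complex.norm_exp, exp_le_one_iff]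
  exact re_lambertPhase_nonpos hy τ

theorem norm_exp_natCast_mul_I (n : ℕ) (t : ℝ) : ‖Complex.exp (n * t * Complex.I)‖ = 1 := by
  have := Complex.norm_exp_ofReal_mul_I (n * t)
  push_cast at this
  exact this

/-- Cauchy's formula for `pk k n` on the circle of radius `exp (-l ^ (-k))`. -/
theorem pk_mul_exp_eq_integral {k : ℕ} (hk : 1 ≤ k) (n : ℕ) {l : ℝ} (hl : 0 < l) :
    (2 * π * (pk k n * exp (-(n * (l ^ k)⁻¹))) : ℂ) = exp (gridSum k 0 l) *
      ∫ t in (-π)..π, Complex.exp (gridPhase k l (t * l ^ k)) * Complex.exp (n * t * Complex.I) := by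
  have hσ : 0 < (l ^ k)⁻¹ := by positivity
  set r := exp (-(l ^ k)⁻¹) with hr
  have hr0 : 0 < r := exp_pos _
  have hr1 : r < 1 := exp_lt_one_iff.2 (by linarith)
  have hpt : ∀ (m : ℕ) (t : ℝ),
      (1 - (r * Complex.exp (-t * Complex.I)) ^ ((m + 1) ^ k))⁻¹ =
      ((exp (lambertSum 0 (((m + 1) / l) ^ k)) : ℝ) : ℂ) *
        Complex.exp (lambertPhase (((m + 1) / l) ^ k) (t * l ^ k)) := by
    intro m t
    have hy : 0 < (((m : ℝ) + 1) / l) ^ k := by positivity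
    rw [← inv_one_sub_exp_eq_mul_exp_lambertPhase hy]
    congr 2
    rw [hr, Complex.ofReal_exp, ← Complex.exp_add, ← Complex.exp_nat_mul]
    congr 1
    push_cast
    rw [div_pow]
    have : (l : ℂ) ≠ 0 := by exact_mod_cast hl.ne'
    field_simp
    ring
  have hM : ∀ M : ℕ, ((exp (∑ m ∈ Finset.range M, lambertSum 0 (((m + 1) / l) ^ k)) : ℝ) : ℂ) *
      ∫ t in (-π)..π, (∏ m ∈ Finset.range M,
        Complex.exp (lambertPhase (((m + 1) / l) ^ k) (t * l ^ k))) *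
          Complex.exp (n * t * Complex.I) =
      2 * π * (PowerSeries.coeff n (powerPartSeries k M) * r ^ n) := by
    intro M
    rw [← integral_hasSum_mul_exp (c := fun j => PowerSeries.coeff j (powerPartSeries k M))
      (f := fun z => ∏ m ∈ Finset.range M, (1 - z ^ ((m + 1) ^ k))⁻¹) hr0.le n
      (fun z hz => hasSum_coeff_powerPartSeries k M (hz.trans_lt hr1)),
      ← intervalIntegral.integral_const_mul]
    refine intervalIntegral.integral_congr fun t _ => ?_
    rw [Finset.prod_congr rfl fun m _ => hpt m t, Finset.prod_mul_distrib, exp_sum]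
    push_cast
    ring
  have h1 : Tendsto (fun M : ℕ =>
      ((exp (∑ m ∈ Finset.range M, lambertSum 0 (((m + 1) / l) ^ k)) : ℝ) : ℂ)) atTop
      (𝓝 ((exp (gridSum k 0 l) : ℝ) : ℂ)) :=
    (Complex.continuous_ofReal.tendsto _).comp ((continuous_exp.tendsto _).comp
      (summable_gridSum hk 0 hl).hasSum.tendsto_sum_nat)
  have h2 : Tendsto (fun M : ℕ => ∫ t in (-π)..π, (∏ m ∈ Finset.range M,
        Complex.exp (lambertPhase (((m + 1) / l) ^ k) (t * l ^ k))) *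
          Complex.exp (n * t * Complex.I)) atTop
      (𝓝 (∫ t in (-π)..π, Complex.exp (gridPhase k l (t * l ^ k)) *
        Complex.exp (n * t * Complex.I))) := by
    refine intervalIntegral.tendsto_integral_filter_of_dominated_convergence (fun _ => 1) ?_ ?_
      (by simp) ?_
    · refine Eventually.of_forall fun M => Measurable.aestronglyMeasurable ?_
      refine Measurable.mul (Finset.measurable_fun_prod _ fun m _ => ?_) (by fun_prop)
      exact (measurable_exp_lambertPhase (by positivity)).comp (measurable_mul_const _)
    · refine Eventually.of_forall fun M => MeasureTheory.ae_of_all _ fun t _ => ?_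
      rw [norm_mul, norm_exp_natCast_mul_I, mul_one, norm_prod]
      exact Finset.prod_le_one (fun _ _ => norm_nonneg _)
        fun m _ => norm_exp_lambertPhase_le_one (by positivity) _
    · exact MeasureTheory.ae_of_all _ fun t _ =>
        (tendsto_prod_exp_lambertPhase hk hl _).mul_const _
  have h3 := h1.mul h2
  simp_rw [hM] at h3
  have h4 := ((tendsto_coeff_powerPartSeries hk n).mul_const ((r : ℂ) ^ n)).const_mul (2 * π : ℂ)
  rw [← tendsto_nhds_unique h4 h3]
  rw [hr, ← Complex.ofReal_pow, ← exp_nat_mul]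
  push_cast
  ring_nf

theorem norm_gridPhase_sub_le {k : ℕ} (hk : 1 ≤ k) {l : ℝ} (hl : 0 < l) (τ : ℝ) :
    ‖gridPhase k l τ + τ * gridSum k 1 l * Complex.I + τ ^ 2 / 2 * gridSum k 2 l‖ ≤
      4 * |τ| ^ 3 * gridSum k 3 l := by
  have hc : ∀ r, HasSum (fun m : ℕ => ((lambertSum r (((m + 1) / l) ^ k) : ℝ) : ℂ))
      ((gridSum k r l : ℝ) : ℂ) := fun r =>
    Complex.hasSum_ofReal.2 (summable_gridSum hk r hl).hasSum
  have h := ((hasSum_gridPhase hk hl τ).add (((hc 1).mul_left (τ : ℂ)).mul_right Complex.I)).add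
    ((hc 2).mul_left ((τ : ℂ) ^ 2 / 2))
  have h3 := ((summable_gridSum hk 3 hl).hasSum).mul_left (4 * |τ| ^ 3)
  rw [← h.tsum_eq]
  exact tsum_of_norm_bounded h3 fun m => norm_lambertPhase_sub_quadratic_le (by positivity) τ

theorem re_gridPhase_le {k : ℕ} (hk : 1 ≤ k) {l : ℝ} (hl : 0 < l) (τ : ℝ) {N : ℕ} (hN : N ≤ l) :
    (gridPhase k l τ).re ≤
      -(exp (-1) * ∑ m ∈ Finset.range N, (1 - cos (((m + 1) / l) ^ k * τ))) := by
  have h := (Complex.hasSum_re (hasSum_gridPhase hk hl τ)).neg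
  have h1 := sum_le_hasSum (Finset.range N) (fun m _ => by
    have := re_lambertPhase_nonpos (y := ((m + 1) / l) ^ k) (by positivity) τ
    linarith) h
  rw [le_neg]
  refine le_trans ?_ h1
  rw [Finset.mul_sum]
  refine Finset.sum_le_sum fun m hm => ?_
  have hy : 0 < (((m : ℝ) + 1) / l) ^ k := by positivity
  have h2 := re_lambertPhase_le hy τ
  have h3 : (((m : ℝ) + 1) / l) ^ k ≤ 1 := by
    refine pow_le_one₀ (by positivity) ?_
    rw [div_le_one hl]
    have : (m : ℝ) + 1 ≤ N := by exact_mod_cast Finset.mem_range.1 hm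
    linarith
  have h4 : exp (-1) ≤ exp (-(((m : ℝ) + 1) / l) ^ k) := by
    rw [exp_le_exp]
    linarith
  have h5 := cos_le_one ((((m : ℝ) + 1) / l) ^ k * τ)
  calc _ ≤ exp (-(((m : ℝ) + 1) / l) ^ k) * (1 - cos ((((m : ℝ) + 1) / l) ^ k * τ)) := by
        gcongr
    _ ≤ _ := by linarith

theorem tendsto_inv_sqrt_atTop_zero : Tendsto (fun l : ℝ => (√l)⁻¹) atTop (𝓝 0) :=
  tendsto_inv_atTop_zero.comp tendsto_sqrt_atTop

theorem tendsto_exp_gridPhase {k : ℕ} (hk : 1 ≤ k) (u : ℝ) :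
    Tendsto (fun l : ℝ => Complex.exp (gridPhase k l (u / √l)) * Complex.exp
        (((∫ x in Set.Ioi 0, lambertSum 1 (x ^ k)) * l * (u / √l) : ℝ) * Complex.I)) atTop
      (𝓝 ((exp (-((∫ x in Set.Ioi 0, lambertSum 2 (x ^ k)) / 2) * u ^ 2) : ℝ) : ℂ)) := by
  set A := ∫ x in Set.Ioi 0, lambertSum 1 (x ^ k) with hA
  set B := ∫ x in Set.Ioi 0, lambertSum 2 (x ^ k) with hB
  simp_rw [← Complex.exp_add, Complex.ofReal_exp]
  refine (Complex.continuous_exp.tendsto _).comp ?_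
  have h1 : Tendsto (fun l : ℝ => gridPhase k l (u / √l) +
      (u / √l : ℝ) * gridSum k 1 l * Complex.I + (u / √l : ℝ) ^ 2 / 2 * gridSum k 2 l)
      atTop (𝓝 0) := by
    have hlim := ((tendsto_inv_sqrt_atTop_zero.mul (tendsto_gridSum hk 3)).const_mul (4 * |u| ^ 3))
    rw [zero_mul, mul_zero] at hlim
    refine squeeze_zero_norm' ?_ hlim
    filter_upwards [eventually_gt_atTop 0] with l hl
    refine (norm_gridPhase_sub_le hk hl _).trans (le_of_eq ?_)
    have hs : √l ≠ 0 := (sqrt_pos.2 hl).ne'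
    rw [abs_div, abs_of_nonneg (sqrt_nonneg l), div_pow, pow_succ (√l) 2, sq_sqrt hl.le]
    field_simp
  have h2 : Tendsto (fun l : ℝ => ((u / √l * (gridSum k 1 l - l * A) : ℝ) : ℂ) * Complex.I)
      atTop (𝓝 0) := by
    have hlim := tendsto_inv_sqrt_atTop_zero.const_mul |u|
    rw [mul_zero] at hlim
    refine squeeze_zero_norm' ?_ hlim
    filter_upwards [eventually_gt_atTop 0] with l hl
    rw [norm_mul, Complex.norm_I, mul_one, Complex.norm_real, norm_mul, norm_div,
      Real.norm_eq_abs, Real.norm_eq_abs, Real.norm_eq_abs, abs_of_nonneg (sqrt_nonneg l)]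
    calc _ ≤ |u| / √l * 1 := by gcongr; exact abs_gridSum_one_sub_le hk hl
      _ = _ := by rw [mul_one, div_eq_mul_inv]
  have h3 : Tendsto (fun l : ℝ => ((u ^ 2 / 2 * (l⁻¹ * gridSum k 2 l) : ℝ) : ℂ))
      atTop (𝓝 ((u ^ 2 / 2 * B : ℝ) : ℂ)) :=
    (Complex.continuous_ofReal.tendsto _).comp ((tendsto_gridSum hk 2).const_mul _)
  have h4 := (h1.sub h2).sub h3
  rw [sub_zero, zero_sub] at h4
  have e : (((-(B / 2) * u ^ 2 : ℝ)) : ℂ) = -((u ^ 2 / 2 * B : ℝ) : ℂ) := by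
    push_cast
    ring
  rw [e]
  refine h4.congr' ?_
  filter_upwards [eventually_gt_atTop 0] with l hl
  have hs : ((u / √l : ℝ) : ℂ) ^ 2 = ((u ^ 2 * l⁻¹ : ℝ) : ℂ) := by
    rw [← Complex.ofReal_pow, div_pow, sq_sqrt hl.le, div_eq_mul_inv]
  rw [hs]
  push_cast
  ring

/-- `|sin (π x)|`, comparable to the distance from `x` to the nearest integer. -/
noncomputable def absSinPi (x : ℝ) : ℝ := |sin (π * x)|

theorem absSinPi_nonneg (x : ℝ) : 0 ≤ absSinPi x := abs_nonneg _

theorem absSinPi_neg (x : ℝ) : absSinPi (-x) = absSinPi x := by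
  rw [absSinPi, mul_neg, sin_neg, abs_neg, absSinPi]

theorem absSinPi_add_le (x y : ℝ) : absSinPi (x + y) ≤ absSinPi x + absSinPi y := by
  unfold absSinPi
  rw [mul_add, sin_add]
  refine (abs_add_le _ _).trans (add_le_add ?_ ?_)
  · rw [abs_mul]
    exact mul_le_of_le_one_right (abs_nonneg _) (abs_cos_le_one _)
  · rw [abs_mul]
    exact mul_le_of_le_one_left (abs_nonneg _) (abs_cos_le_one _)

theorem absSinPi_natCast_mul_le (n : ℕ) (x : ℝ) : absSinPi (n * x) ≤ n * absSinPi x := by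
  induction n with
  | zero => simp [absSinPi]
  | succ n ih =>
    have := absSinPi_add_le (n * x) x
    push_cast
    rw [add_mul, add_mul, one_mul, one_mul]
    linarith

theorem absSinPi_sum_le {ι : Type*} (s : Finset ι) (g : ι → ℝ) :
    absSinPi (∑ i ∈ s, g i) ≤ ∑ i ∈ s, absSinPi (g i) := by
  classical
  induction s using Finset.induction_on with
  | empty => simp [absSinPi]
  | insert a s ha ih =>
    rw [Finset.sum_insert ha, Finset.sum_insert ha]
    exact (absSinPi_add_le _ _).trans (by linarith)

theorem absSinPi_add_intCast (x : ℝ) (n : ℤ) : absSinPi (x + n) = absSinPi x := by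
  unfold absSinPi
  rw [show π * (x + n) = π * x + n * π by ring, sin_add_int_mul_pi, abs_mul]
  simp [abs_zpow]

theorem absSinPi_le (x : ℝ) : absSinPi x ≤ π * |x| := by
  refine abs_sin_le_abs.trans ?_
  rw [abs_mul, abs_of_pos pi_pos]

theorem two_mul_abs_le_absSinPi {x : ℝ} (hx : |x| ≤ 1 / 2) : 2 * |x| ≤ absSinPi x := by
  have h : absSinPi x = absSinPi |x| := by
    rcases abs_choice x with h | h <;> rw [h]
    rw [absSinPi_neg]
  rw [h]
  have := mul_le_sin (x := π * |x|) (by positivity) (by nlinarith [pi_pos])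
  calc 2 * |x| = 2 / π * (π * |x|) := by field_simp
    _ ≤ _ := this.trans (le_abs_self _)

theorem sum_choose_mul_pow_eq (k : ℕ) (x : ℝ) {d : ℝ} (hd : d ≠ 0) :
    ∑ j ∈ Finset.range (k + 1), (-1 : ℝ) ^ (k - j) * k.choose j * (x + j * d) ^ k =
      k.factorial * d ^ k := by
  have h := congr_fun (fwdDiff_iter_eq_factorial (R := ℝ) (n := k)) (x / d)
  rw [fwdDiff_iter_eq_sum_shift] at h
  have h' : ∑ j ∈ Finset.range (k + 1), (-1 : ℝ) ^ (k - j) * k.choose j * (x / d + j) ^ k =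
      k.factorial := by
    simpa using h
  rw [← h', Finset.sum_mul]
  refine Finset.sum_congr rfl fun j _ => ?_
  rw [mul_assoc _ _ (d ^ k), ← mul_pow, add_mul, div_mul_cancel₀ _ hd]

theorem absSinPi_factorial_mul_le (k : ℕ) (x : ℝ) {d : ℝ} (hd : d ≠ 0) (α : ℝ) :
    absSinPi (k.factorial * d ^ k * α) ≤
      ∑ j ∈ Finset.range (k + 1), k.choose j * absSinPi ((x + j * d) ^ k * α) := by
  rw [← sum_choose_mul_pow_eq k x hd, Finset.sum_mul]
  refine (absSinPi_sum_le _ _).trans (Finset.sum_le_sum fun j _ => ?_)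
  have : absSinPi ((-1 : ℝ) ^ (k - j) * k.choose j * (x + j * d) ^ k * α) =
      absSinPi (k.choose j * ((x + j * d) ^ k * α)) := by
    rcases neg_one_pow_eq_or ℝ (k - j) with h | h <;> rw [h]
    · congr 1
      ring
    · rw [← absSinPi_neg]
      congr 1
      ring
  rw [this]
  exact absSinPi_natCast_mul_le _ _

/-- `∑ |sin (π m ^ k α)|` over `1 ≤ m ≤ N`. -/
noncomputable def sinPowSum (k N : ℕ) (α : ℝ) : ℝ :=
  ∑ m ∈ Finset.range N, absSinPi (((m : ℝ) + 1) ^ k * α)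

theorem mul_absSinPi_factorial_le (k : ℕ) {X d N : ℕ} (hd : 0 < d) (hN : X + k * d ≤ N) (α : ℝ) :
    X * absSinPi (k.factorial * (d : ℝ) ^ k * α) ≤ 2 ^ k * sinPowSum k N α := by
  have hd' : (d : ℝ) ≠ 0 := by positivity
  calc X * absSinPi (k.factorial * (d : ℝ) ^ k * α)
      = ∑ x ∈ Finset.range X, absSinPi (k.factorial * (d : ℝ) ^ k * α) := by simp
    _ ≤ ∑ x ∈ Finset.range X, ∑ j ∈ Finset.range (k + 1),
        k.choose j * absSinPi ((((x : ℝ) + 1) + j * d) ^ k * α) :=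
      Finset.sum_le_sum fun x _ => absSinPi_factorial_mul_le k _ hd' α
    _ = ∑ j ∈ Finset.range (k + 1), k.choose j * ∑ x ∈ Finset.range X,
        absSinPi ((((x : ℝ) + 1) + j * d) ^ k * α) := by
      rw [Finset.sum_comm]
      simp_rw [Finset.mul_sum]
    _ ≤ ∑ j ∈ Finset.range (k + 1), k.choose j * sinPowSum k N α := by
      refine Finset.sum_le_sum fun j hj => mul_le_mul_of_nonneg_left ?_ (by positivity)
      have hj' : j ≤ k := by
        have := Finset.mem_range.1 hj
        omega
      have hjd : j * d ≤ k * d := Nat.mul_le_mul_right d hj'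
      have e : ∑ x ∈ Finset.range X, absSinPi ((((x : ℝ) + 1) + j * d) ^ k * α) =
          ∑ m ∈ (Finset.range X).image (· + j * d), absSinPi (((m : ℝ) + 1) ^ k * α) := by
        rw [Finset.sum_image fun a _ b _ h => by simpa using h]
        refine Finset.sum_congr rfl fun x _ => ?_
        push_cast
        congr 3
        ring
      rw [e, sinPowSum]
      refine Finset.sum_le_sum_of_subset_of_nonneg ?_ fun _ _ _ => absSinPi_nonneg _
      intro m hm
      obtain ⟨x, hx, rfl⟩ := Finset.mem_image.1 hm
      rw [Finset.mem_range] at hx ⊢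
      omega
    _ = _ := by
      rw [← Finset.sum_mul]
      congr 1
      exact_mod_cast Nat.sum_range_choose k

/-- If `β d ^ k` stays near integers for all `d ≤ D`, then `β` is within `O(D ^ (-k))` of one. -/
theorem pow_mul_abs_sub_round_le (k : ℕ) {D : ℕ} (hD : 1 ≤ D) {β ε : ℝ} (hε : 2 ^ k * ε ≤ 1)
    (h : ∀ d : ℕ, 1 ≤ d → d ≤ D → absSinPi ((d : ℝ) ^ k * β) ≤ ε) :
    (D : ℝ) ^ k * |β - round β| ≤ ε / 2 := by
  have hf : ∀ d : ℕ, absSinPi ((d : ℝ) ^ k * (β - round β)) = absSinPi ((d : ℝ) ^ k * β) := by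
    intro d
    rw [← absSinPi_add_intCast _ ((d : ℤ) ^ k * round β)]
    congr 1
    push_cast
    ring
  induction D, hD using Nat.le_induction with
  | base =>
    have h1 := h 1 le_rfl le_rfl
    rw [← hf] at h1
    have h2 := two_mul_abs_le_absSinPi (abs_sub_round β)
    simp only [Nat.cast_one, one_pow, one_mul] at h1 ⊢
    linarith
  | succ D hD ih =>
    have ih' := ih fun d h1 h2 => h d h1 (by omega)
    have h1 := h (D + 1) (by omega) le_rfl
    rw [← hf] at h1
    have hle : ((D + 1 : ℕ) : ℝ) ^ k * |β - round β| ≤ 1 / 2 := by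
      have h3 : ((D + 1 : ℕ) : ℝ) ≤ 2 * D := by
        have : (1 : ℝ) ≤ D := by exact_mod_cast hD
        push_cast
        linarith
      calc _ ≤ (2 * (D : ℝ)) ^ k * |β - round β| := by gcongr
        _ = 2 ^ k * ((D : ℝ) ^ k * |β - round β|) := by ring
        _ ≤ 2 ^ k * (ε / 2) := by gcongr
        _ ≤ _ := by linarith
    have habs : |((D + 1 : ℕ) : ℝ) ^ k * (β - round β)| =
        ((D + 1 : ℕ) : ℝ) ^ k * |β - round β| := by
      rw [abs_mul, abs_of_nonneg (by positivity)]
    have h2 := two_mul_abs_le_absSinPi (habs.trans_le hle)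
    rw [habs] at h2
    linarith

/-- The terms with `m ≡ 1 [MOD q]` show that `|sin (π α)|` is small when `sinPowSum` is and `q α`
is close to an integer. -/
theorem absSinPi_le_of_sinPowSum_le (k : ℕ) {q N : ℕ} (hq : 1 ≤ q) (hN : 1 ≤ N) {α δ η : ℝ}
    (hT : sinPowSum k N α ≤ δ * N) (hη : (N : ℝ) ^ k * |q * α - round (q * α)| ≤ η) :
    absSinPi α ≤ q * δ + π * η := by
  set W := (N - 1) / q + 1 with hW
  have hWN : N ≤ W * q := by
    have h1 := Nat.div_add_mod (N - 1) q
    have h2 := Nat.mod_lt (N - 1) (by omega : q > 0)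
    rw [hW, add_mul, one_mul, mul_comm]
    omega
  have hpt : ∀ w ∈ Finset.range W, absSinPi α - π * η ≤
      absSinPi (((q * w : ℕ) + 1 : ℝ) ^ k * α) := by
    intro w hw
    have hqw : q * w + 1 ≤ N := by
      have h1 : w ≤ (N - 1) / q := by
        have := Finset.mem_range.1 hw
        omega
      have h2 := Nat.mul_le_mul_left q h1
      have h3 := Nat.mul_div_le (N - 1) q
      omega
    obtain ⟨v, hv⟩ : q ∣ (q * w + 1) ^ k - 1 := by
      have : q * w + 1 - 1 ∣ (q * w + 1) ^ k - 1 ^ k := Nat.sub_dvd_pow_sub_pow _ _ k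
      rw [one_pow, Nat.add_sub_cancel] at this
      exact (Dvd.intro _ rfl).trans this
    have hv1 : (q * w + 1) ^ k = 1 + q * v := by
      have : 0 < (q * w + 1) ^ k := by positivity
      omega
    have hvN : (v : ℝ) ≤ (N : ℝ) ^ k := by
      have h1 : v ≤ q * v := Nat.le_mul_of_pos_left v (by omega)
      have h2 : (q * w + 1) ^ k ≤ N ^ k := Nat.pow_le_pow_left hqw k
      have : v ≤ N ^ k := by omega
      exact_mod_cast this
    have hv2 : (((q * w : ℕ) : ℝ) + 1) ^ k = 1 + q * v := by exact_mod_cast hv1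
    set γ := (q : ℝ) * α - round (q * α) with hγ
    have e1 : absSinPi (((q * w : ℕ) + 1 : ℝ) ^ k * α) = absSinPi (α + v * γ) := by
      rw [hv2, ← absSinPi_add_intCast (α + v * γ) (v * round (q * α))]
      congr 1
      push_cast
      rw [hγ]
      ring
    have e2 : absSinPi α ≤ absSinPi (α + v * γ) + absSinPi (-(v * γ)) := by
      have := absSinPi_add_le (α + v * γ) (-(v * γ))
      rwa [add_neg_cancel_right] at this
    have e3 : absSinPi (-(v * γ)) ≤ π * η := by
      rw [absSinPi_neg]
      refine (absSinPi_le _).trans ?_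
      rw [abs_mul, Nat.abs_cast]
      gcongr
      exact le_trans (by gcongr) hη
    rw [e1]
    linarith
  have hsum : (W : ℝ) * (absSinPi α - π * η) ≤ δ * N := by
    refine le_trans ?_ hT
    calc (W : ℝ) * (absSinPi α - π * η) = ∑ w ∈ Finset.range W, (absSinPi α - π * η) := by
          simp [mul_sub]
      _ ≤ ∑ w ∈ Finset.range W, absSinPi (((q * w : ℕ) + 1 : ℝ) ^ k * α) :=
        Finset.sum_le_sum hpt
      _ = ∑ m ∈ (Finset.range W).image (q * ·), absSinPi (((m : ℝ) + 1) ^ k * α) := by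
        rw [Finset.sum_image fun a _ b _ h => Nat.eq_of_mul_eq_mul_left (by omega) h]
      _ ≤ _ := by
        refine Finset.sum_le_sum_of_subset_of_nonneg ?_ fun _ _ _ => absSinPi_nonneg _
        intro m hm
        obtain ⟨w, hw, rfl⟩ := Finset.mem_image.1 hm
        rw [Finset.mem_range] at hw ⊢
        have h1 : w ≤ (N - 1) / q := by omega
        have h2 := Nat.mul_le_mul_left q h1
        have h3 := Nat.mul_div_le (N - 1) q
        omega
  have hδ : 0 ≤ δ := by
    have h1 : 0 ≤ sinPowSum k N α := Finset.sum_nonneg fun _ _ => absSinPi_nonneg _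
    have h2 : (0 : ℝ) < N := by exact_mod_cast hN
    exact nonneg_of_mul_nonneg_left (h1.trans hT) h2
  have hW0 : (0 : ℝ) < W := by rw [hW]; positivity
  have h3 : (N : ℝ) ≤ W * q := by exact_mod_cast hWN
  have h4 : (W : ℝ) * (absSinPi α - π * η) ≤ W * (q * δ) := by
    refine hsum.trans ?_
    nlinarith
  have := le_of_mul_le_mul_left h4 hW0
  linarith

theorem le_sinPowSum_of_abs_le (k : ℕ) {N : ℕ} {α : ℝ} (h : (N : ℝ) ^ k * |α| ≤ 1 / 2) :
    N * ((N : ℝ) ^ k * |α|) / 2 ^ k ≤ sinPowSum k N α := by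
  have hsub : Finset.Ico (N / 2) N ⊆ Finset.range N := by
    intro m hm
    exact Finset.mem_range.2 (Finset.mem_Ico.1 hm).2
  have hpt : ∀ m ∈ Finset.Ico (N / 2) N, 2 * (((N : ℝ) / 2) ^ k * |α|) ≤
      absSinPi (((m : ℝ) + 1) ^ k * α) := by
    intro m hm
    obtain ⟨h1, h2⟩ := Finset.mem_Ico.1 hm
    have h1' : (N : ℝ) / 2 ≤ m + 1 := by
      have : N ≤ 2 * (m + 1) := by omega
      have : (N : ℝ) ≤ 2 * (m + 1) := by exact_mod_cast this
      linarith
    have h2' : (m : ℝ) + 1 ≤ N := by exact_mod_cast h2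
    have habs : |((m : ℝ) + 1) ^ k * α| = ((m : ℝ) + 1) ^ k * |α| := by
      rw [abs_mul, abs_of_nonneg (by positivity)]
    have hle : |((m : ℝ) + 1) ^ k * α| ≤ 1 / 2 := by
      rw [habs]
      exact le_trans (by gcongr) h
    refine le_trans ?_ (two_mul_abs_le_absSinPi hle)
    rw [habs]
    gcongr
  have hcard : (N : ℝ) / 2 ≤ (Finset.Ico (N / 2) N).card := by
    rw [Nat.card_Ico]
    have : N ≤ 2 * (N - N / 2) := by omega
    have : (N : ℝ) ≤ 2 * ((N - N / 2 : ℕ) : ℝ) := by exact_mod_cast this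
    linarith
  calc N * ((N : ℝ) ^ k * |α|) / 2 ^ k = (N : ℝ) / 2 * (2 * (((N : ℝ) / 2) ^ k * |α|)) := by
        rw [div_pow]
        ring
    _ ≤ (Finset.Ico (N / 2) N).card * (2 * (((N : ℝ) / 2) ^ k * |α|)) := by gcongr
    _ ≤ ∑ m ∈ Finset.Ico (N / 2) N, absSinPi (((m : ℝ) + 1) ^ k * α) := by
      rw [← nsmul_eq_mul]
      exact Finset.card_nsmul_le_sum _ _ _ hpt
    _ ≤ _ := Finset.sum_le_sum_of_subset_of_nonneg hsub fun _ _ _ => absSinPi_nonneg _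

/-- A Weyl type lower bound for `∑ |sin (π m ^ k α)|`. -/
theorem exists_mul_min_le_sinPowSum {k : ℕ} (hk : 1 ≤ k) :
    ∃ c : ℝ, 0 < c ∧ ∀ N : ℕ, 2 * k ≤ N → ∀ α : ℝ, |α| ≤ 1 / 2 →
      c * N * min 1 ((N : ℝ) ^ k * |α|) ≤ sinPowSum k N α := by
  set q := k.factorial with hq
  have hq1 : 1 ≤ q := Nat.factorial_pos k
  have hq1' : (1 : ℝ) ≤ q := by exact_mod_cast hq1
  have hk1' : (1 : ℝ) ≤ k := by exact_mod_cast hk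
  set P : ℝ := (4 * k) ^ k with hP
  have hP1 : 1 ≤ P := one_le_pow₀ (by linarith)
  set δ : ℝ := 1 / (16 * 4 ^ k * q ^ 2 * P) with hδ
  have hδ0 : 0 < δ := by positivity
  have hδ1 : δ * (4 ^ k * q ^ 2 * P) = 1 / 16 := by
    rw [hδ]
    field_simp
  refine ⟨min δ (1 / 2 ^ k), by positivity, fun N hN α hα => ?_⟩
  have hN0 : 1 ≤ N := by omega
  have hN0' : (0 : ℝ) < N := by exact_mod_cast hN0
  by_cases hT : δ * N ≤ sinPowSum k N α
  · refine le_trans ?_ hT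
    calc _ ≤ δ * N * 1 := by
          gcongr
          · exact min_le_left _ _
          · exact min_le_left _ _
      _ = _ := mul_one _
  have hT' : sinPowSum k N α ≤ δ * N := (not_le.1 hT).le
  set D := N / (2 * k) with hD
  have hD1 : 1 ≤ D := (Nat.one_le_div_iff (by omega)).2 hN
  have hDN : 2 * k * D ≤ N := Nat.mul_div_le N (2 * k)
  have hND : (N : ℝ) ≤ 4 * k * D := by
    have h1 := Nat.div_add_mod N (2 * k)
    have h2 := Nat.mod_lt N (by omega : 2 * k > 0)
    have h3 : 2 * k * 1 ≤ 2 * k * D := Nat.mul_le_mul_left _ hD1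
    have h4 : N ≤ 2 * (2 * k * D) := by
      rw [← hD] at h1
      omega
    have h5 : (N : ℝ) ≤ 2 * (2 * k * D) := by exact_mod_cast h4
    linarith
  set ε : ℝ := 3 * 2 ^ k * δ with hε
  have h24 : (4 : ℝ) ^ k = 2 ^ k * 2 ^ k := by
    rw [← mul_pow]
    norm_num
  have h2k : (1 : ℝ) ≤ 2 ^ k := one_le_pow₀ (by norm_num)
  have hεP : 2 ^ k * ε * q ^ 2 * P = 3 / 16 := by
    calc _ = 3 * (δ * ((2 ^ k * 2 ^ k) * q ^ 2 * P)) := by rw [hε]; ring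
      _ = _ := by rw [← h24, hδ1]; norm_num
  have hε0 : 0 < ε := by positivity
  have hsmall : ∀ d : ℕ, 1 ≤ d → d ≤ D → absSinPi ((d : ℝ) ^ k * (q * α)) ≤ ε := by
    intro d hd1 hdD
    have hkd : k * d ≤ k * D := Nat.mul_le_mul_left k hdD
    have hkD : 2 * (k * D) ≤ N := by rw [← mul_assoc]; exact hDN
    have h1 := mul_absSinPi_factorial_le k (X := N / 2) (N := N) hd1 (by omega) α
    have hX : (N : ℝ) ≤ 3 * ((N / 2 : ℕ) : ℝ) := by
      have : N ≤ 3 * (N / 2) := by omega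
      exact_mod_cast this
    have h2 : (N : ℝ) * absSinPi (q * (d : ℝ) ^ k * α) ≤ N * ε := by
      calc _ ≤ 3 * ((N / 2 : ℕ) : ℝ) * absSinPi (q * (d : ℝ) ^ k * α) := by
            have := absSinPi_nonneg (q * (d : ℝ) ^ k * α)
            gcongr
        _ ≤ 3 * (2 ^ k * sinPowSum k N α) := by rw [mul_assoc]; gcongr
        _ ≤ 3 * (2 ^ k * (δ * N)) := by gcongr
        _ = _ := by rw [hε]; ring
    have h3 := le_of_mul_le_mul_left h2 hN0'
    rwa [show (d : ℝ) ^ k * (q * α) = q * (d : ℝ) ^ k * α by ring]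
  have hq2 : (1 : ℝ) ≤ q ^ 2 * P := by
    have : (1 : ℝ) ≤ q ^ 2 := one_le_pow₀ hq1'
    nlinarith
  have hε1 : 2 ^ k * ε ≤ 1 := by
    have : 2 ^ k * ε * 1 ≤ 2 ^ k * ε * (q ^ 2 * P) := by gcongr
    linarith
  have hround := pow_mul_abs_sub_round_le k hD1 hε1 hsmall
  set γ := (q : ℝ) * α - round ((q : ℝ) * α) with hγ
  have hη : (N : ℝ) ^ k * |γ| ≤ P * ε / 2 := by
    calc _ ≤ (4 * k * D : ℝ) ^ k * |γ| := by gcongr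
      _ = P * ((D : ℝ) ^ k * |γ|) := by rw [hP, mul_pow]; ring
      _ ≤ P * (ε / 2) := by gcongr
      _ = _ := by ring
  have hqPε : (q : ℝ) * (P * ε) ≤ 3 / 16 := by
    calc (q : ℝ) * (P * ε) = 1 * (q * 1) * (P * ε) := by ring
      _ ≤ 2 ^ k * (q * q) * (P * ε) := by gcongr
      _ = 2 ^ k * ε * q ^ 2 * P := by ring
      _ ≤ _ := hεP.le
  have hqqδ : (q : ℝ) * (q * δ) ≤ 1 / 16 := by
    have h4k : (1 : ℝ) ≤ 4 ^ k := one_le_pow₀ (by norm_num)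
    calc (q : ℝ) * (q * δ) = δ * (1 * q ^ 2 * 1) := by ring
      _ ≤ δ * (4 ^ k * q ^ 2 * P) := by gcongr
      _ = _ := hδ1
  have hsin := absSinPi_le_of_sinPowSum_le k hq1 hN0 hT' hη
  have hα2 := two_mul_abs_le_absSinPi hα
  have hqα : |(q : ℝ) * α| < 1 / 2 := by
    rw [abs_mul, Nat.abs_cast]
    have h1 : (q : ℝ) * (2 * |α|) ≤ q * (q * δ + π * (P * ε / 2)) := by
      gcongr
      linarith
    have h2 : (q : ℝ) * (q * δ + π * (P * ε / 2)) = q * (q * δ) + π * (q * (P * ε)) / 2 := by ring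
    have h3 : π * (q * (P * ε)) ≤ 4 * (3 / 16) := by
      gcongr
      exact pi_le_four
    linarith
  have hr0 : round ((q : ℝ) * α) = 0 := by
    rw [round_eq_zero_iff]
    rw [abs_lt] at hqα
    exact ⟨hqα.1.le, hqα.2⟩
  have hαγ : |α| ≤ |γ| := by
    rw [hγ, hr0, Int.cast_zero, sub_zero, abs_mul, Nat.abs_cast]
    exact le_mul_of_one_le_left (abs_nonneg _) hq1'
  have hNα : (N : ℝ) ^ k * |α| ≤ 1 / 2 := by
    have h1 : (N : ℝ) ^ k * |α| ≤ (N : ℝ) ^ k * |γ| := by gcongr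
    have h2 : 1 * (P * ε) ≤ q * (P * ε) := by gcongr
    linarith
  refine le_trans ?_ (le_sinPowSum_of_abs_le k hNα)
  calc _ ≤ 1 / 2 ^ k * N * ((N : ℝ) ^ k * |α|) := by
        gcongr
        · exact min_le_right _ _
        · exact min_le_right _ _
    _ = _ := by ring

theorem sum_one_sub_cos_ge {k : ℕ} {c : ℝ} {N : ℕ} (hN : 0 < N) {α : ℝ}
    (h : c ≤ sinPowSum k N α) (hc : 0 ≤ c) :
    2 * (c ^ 2 / N) ≤ ∑ m ∈ Finset.range N, (1 - cos (2 * (π * (((m : ℝ) + 1) ^ k * α)))) := by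
  have h1 : ∀ x : ℝ, 1 - cos (2 * (π * x)) = 2 * absSinPi x ^ 2 := by
    intro x
    rw [absSinPi, sq_abs, cos_two_mul, cos_sq']
    ring
  simp_rw [h1, ← Finset.mul_sum]
  gcongr
  have h2 := sq_sum_le_card_mul_sum_sq (s := Finset.range N)
    (f := fun m : ℕ => absSinPi (((m : ℝ) + 1) ^ k * α))
  rw [Finset.card_range] at h2
  rw [div_le_iff₀ (by exact_mod_cast hN), mul_comm]
  refine le_trans ?_ h2
  exact pow_le_pow_left₀ hc h 2

theorem exists_norm_exp_gridPhase_le {k : ℕ} (hk : 1 ≤ k) :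
    ∃ c K L : ℝ, 0 < c ∧ 0 < K ∧ ∀ l : ℝ, L ≤ l → ∀ u : ℝ, |u| ≤ π * (√l * l ^ k) →
      ‖Complex.exp (gridPhase k l (u / √l))‖ ≤ exp (-c * u ^ 2) + K / (1 + u ^ 2) := by
  obtain ⟨c₀, hc₀, hW⟩ := exists_mul_min_le_sinPowSum hk
  set a : ℝ := exp (-1) * c₀ ^ 2 with ha
  have ha0 : 0 < a := by positivity
  set K : ℝ := 1 + π ^ 2 * ((2 * k + 1).factorial / a ^ (2 * k + 1)) with hK
  have hK0 : 0 < K := by positivity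
  refine ⟨exp (-1) * (2 * c₀ ^ 2 / (4 * π ^ 2 * 2 ^ (2 * k + 1))), K, 2 * k + 1, by positivity, hK0,
    fun l hl u hu => ?_⟩
  have hk1 : (1 : ℝ) ≤ k := by exact_mod_cast hk
  have hl1 : 1 ≤ l := by linarith
  have hl0 : 0 < l := by linarith
  have hs0 : 0 < √l := sqrt_pos.2 hl0
  have hs2 : √l ^ 2 = l := sq_sqrt hl0.le
  set N := ⌊l⌋₊ with hN
  have hNl : (N : ℝ) ≤ l := Nat.floor_le hl0.le
  have hNk : 2 * k ≤ N := by
    rw [hN, Nat.le_floor_iff hl0.le]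
    push_cast
    linarith
  have hN0 : 0 < N := by omega
  have hN0' : (0 : ℝ) < N := by exact_mod_cast hN0
  have hlN : l / 2 ≤ N := by
    have h1 := Nat.lt_floor_add_one l
    have h2 : (1 : ℝ) ≤ N := by exact_mod_cast hN0
    linarith
  set R := √l * l ^ k with hR
  have hR0 : 0 < R := by positivity
  set α := u / (2 * π * R) with hα
  have hαabs : |α| = |u| / (2 * π * R) := by
    rw [hα, abs_div, abs_of_pos (by positivity : 0 < 2 * π * R)]
  have hα2 : |α| ≤ 1 / 2 := by
    rw [hαabs, div_le_iff₀ (by positivity)]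
    linarith
  have hre := re_gridPhase_le hk hl0 (u / √l) hNl
  have harg : ∀ m : ℕ, (((m : ℝ) + 1) / l) ^ k * (u / √l) =
      2 * (π * (((m : ℝ) + 1) ^ k * α)) := by
    intro m
    rw [hα, hR, div_pow]
    field_simp
  simp_rw [harg] at hre
  have hcos := sum_one_sub_cos_ge hN0 (hW N hNk α hα2) (by positivity)
  have hre' : (gridPhase k l (u / √l)).re ≤ -(exp (-1) *
      (2 * ((c₀ * N * min 1 ((N : ℝ) ^ k * |α|)) ^ 2 / N))) := by
    refine hre.trans (neg_le_neg ?_)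
    gcongr
  have hsimp : (c₀ * N * min 1 ((N : ℝ) ^ k * |α|)) ^ 2 / N =
      c₀ ^ 2 * N * (min 1 ((N : ℝ) ^ k * |α|)) ^ 2 := by
    field_simp
  rw [hsimp] at hre'
  rw [Complex.norm_exp]
  have hu0 : 0 ≤ K / (1 + u ^ 2) := by positivity
  rcases le_total 1 ((N : ℝ) ^ k * |α|) with h | h
  · rw [min_eq_left h] at hre'
    have h1 : (gridPhase k l (u / √l)).re ≤ -(a * l) := by
      refine hre'.trans (neg_le_neg ?_)
      calc a * l = exp (-1) * (2 * (c₀ ^ 2 * (l / 2) * 1 ^ 2)) := by rw [ha]; ring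
        _ ≤ _ := by gcongr
    have h2 : exp (-(a * l)) ≤ K / (1 + u ^ 2) := by
      rw [le_div_iff₀ (by positivity)]
      have h3 : u ^ 2 ≤ π ^ 2 * l ^ (2 * k + 1) := by
        calc u ^ 2 = |u| ^ 2 := (sq_abs u).symm
          _ ≤ (π * R) ^ 2 := by gcongr
          _ = π ^ 2 * (√l ^ 2 * (l ^ k) ^ 2) := by rw [hR]; ring
          _ = π ^ 2 * l ^ (2 * k + 1) := by rw [hs2]; ring
      have h4 := pow_div_factorial_le_exp (a * l) (by positivity) (2 * k + 1)
      have h5 : exp (-(a * l)) * l ^ (2 * k + 1) ≤ (2 * k + 1).factorial / a ^ (2 * k + 1) := by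
        rw [exp_neg, inv_mul_le_iff₀ (exp_pos _)]
        rw [div_le_iff₀ (by positivity), mul_pow] at h4
        rw [mul_div_assoc', le_div_iff₀ (by positivity)]
        linarith
      have h6 : exp (-(a * l)) ≤ 1 := exp_le_one_iff.2 (by
        have : 0 < a * l := by positivity
        linarith)
      calc exp (-(a * l)) * (1 + u ^ 2)
          ≤ exp (-(a * l)) * (1 + π ^ 2 * l ^ (2 * k + 1)) := by gcongr
        _ = exp (-(a * l)) + π ^ 2 * (exp (-(a * l)) * l ^ (2 * k + 1)) := by ring
        _ ≤ _ := by rw [hK]; gcongr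
    calc _ ≤ exp (-(a * l)) := exp_le_exp.2 h1
      _ ≤ K / (1 + u ^ 2) := h2
      _ ≤ _ := le_add_of_nonneg_left (exp_pos _).le
  · rw [min_eq_right h] at hre'
    refine le_trans (exp_le_exp.2 (hre'.trans ?_)) (le_add_of_nonneg_right hu0)
    rw [neg_mul, neg_le_neg_iff]
    have h1 : u ^ 2 = 4 * π ^ 2 * (l ^ (2 * k + 1) * |α| ^ 2) := by
      rw [hαabs, div_pow, sq_abs, mul_pow, mul_pow, hR, mul_pow, hs2]
      field_simp
      ring
    calc exp (-1) * (2 * c₀ ^ 2 / (4 * π ^ 2 * 2 ^ (2 * k + 1))) * u ^ 2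
        = exp (-1) * (2 * (c₀ ^ 2 * ((l / 2) ^ (2 * k + 1) * |α| ^ 2))) := by
          rw [h1, div_pow]
          field_simp
      _ ≤ exp (-1) * (2 * (c₀ ^ 2 * ((N : ℝ) ^ (2 * k + 1) * |α| ^ 2))) := by gcongr
      _ = _ := by ring

theorem tendsto_integral_exp_gridPhase {k : ℕ} (hk : 1 ≤ k)
    (hB : 0 < ∫ x in Set.Ioi 0, lambertSum 2 (x ^ k)) :
    Tendsto (fun l : ℝ => ∫ u in (-(π * (√l * l ^ k)))..(π * (√l * l ^ k)),
      Complex.exp (gridPhase k l (u / √l)) * Complex.exp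
        (((∫ x in Set.Ioi 0, lambertSum 1 (x ^ k)) * l * (u / √l) : ℝ) * Complex.I)) atTop
      (𝓝 ((√(2 * π / ∫ x in Set.Ioi 0, lambertSum 2 (x ^ k)) : ℝ) : ℂ)) := by
  set A := ∫ x in Set.Ioi 0, lambertSum 1 (x ^ k) with hA
  set B := ∫ x in Set.Ioi 0, lambertSum 2 (x ^ k) with hBdef
  obtain ⟨c, K, L, hc, hK, hbound⟩ := exists_norm_exp_gridPhase_le hk
  have hRtop : Tendsto (fun l : ℝ => π * (√l * l ^ k)) atTop atTop := by
    refine Tendsto.const_mul_atTop pi_pos ?_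
    exact tendsto_sqrt_atTop.atTop_mul_atTop₀ (tendsto_pow_atTop (by omega))
  set G : ℝ → ℝ → ℂ := fun l u => Complex.exp (gridPhase k l (u / √l)) *
    Complex.exp ((A * l * (u / √l) : ℝ) * Complex.I) with hG
  have hnorm : ∀ l u, ‖G l u‖ = ‖Complex.exp (gridPhase k l (u / √l))‖ := by
    intro l u
    rw [hG, norm_mul, Complex.norm_exp_ofReal_mul_I, mul_one]
  have hlim : Tendsto (fun l : ℝ => ∫ u, (Set.Ioc (-(π * (√l * l ^ k))) (π * (√l * l ^ k))).indicator
      (G l) u) atTop (𝓝 (∫ u : ℝ, ((exp (-(B / 2) * u ^ 2) : ℝ) : ℂ))) := by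
    refine MeasureTheory.tendsto_integral_filter_of_dominated_convergence
      (fun u => exp (-c * u ^ 2) + K / (1 + u ^ 2)) ?_ ?_
      ((integrable_exp_neg_mul_sq hc).add (integrable_div_one_add_sq K)) ?_
    · filter_upwards [eventually_gt_atTop 0] with l hl
      refine (Measurable.indicator ?_ measurableSet_Ioc).aestronglyMeasurable
      refine Measurable.mul ((measurable_exp_gridPhase hk hl).comp (measurable_id.div_const _)) ?_
      fun_prop
    · filter_upwards [eventually_ge_atTop L] with l hl
      refine MeasureTheory.ae_of_all _ fun u => ?_
      by_cases hu : u ∈ Set.Ioc (-(π * (√l * l ^ k))) (π * (√l * l ^ k))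
      · rw [Set.indicator_of_mem hu, hnorm]
        exact hbound l hl u (abs_le.2 ⟨hu.1.le, hu.2⟩)
      · rw [Set.indicator_of_notMem hu, norm_zero]
        positivity
    · refine MeasureTheory.ae_of_all _ fun u => ?_
      refine (tendsto_exp_gridPhase hk u).congr' ?_
      filter_upwards [hRtop.eventually_gt_atTop |u|] with l hl
      rw [abs_lt] at hl
      rw [Set.indicator_of_mem (Set.mem_Ioc.2 ⟨hl.1, hl.2.le⟩)]
  have hval : ∫ u : ℝ, ((exp (-(B / 2) * u ^ 2) : ℝ) : ℂ) = ((√(2 * π / B) : ℝ) : ℂ) := by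
    rw [integral_complex_ofReal, integral_gaussian]
    congr 2
    field_simp
  rw [hval] at hlim
  refine hlim.congr' ?_
  filter_upwards [hRtop.eventually_gt_atTop 0] with l hl
  rw [MeasureTheory.integral_indicator measurableSet_Ioc,
    intervalIntegral.integral_of_le (by linarith)]

theorem saddle_main_term_eq {k : ℕ} (hk : 1 ≤ k) {A l x : ℝ} (hA : 0 < A) (hl : 0 < l)
    (hx : x = A * l ^ (k + 1)) :
    exp ((A + k * A) * l) * (2 * π * l) ^ (-((k : ℝ) / 2)) *
        (√(2 * π / ((1 + 1 / (k : ℝ)) * A)) / (2 * π * (√l * l ^ k))) =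
      A ^ ((k : ℝ) / (k + 1)) / ((2 * π) ^ (((k : ℝ) + 1) / 2) * √(1 + 1 / (k : ℝ))) *
        exp ((k + 1) * A ^ ((k : ℝ) / (k + 1)) * x ^ ((1 : ℝ) / (k + 1))) /
        x ^ ((3 * (k : ℝ) + 1) / (2 * k + 2)) := by
  have hk0 : (0 : ℝ) < k := by exact_mod_cast hk
  have hk1 : (k : ℝ) + 1 ≠ 0 := by positivity
  have hpow : x ^ ((1 : ℝ) / (k + 1)) = A ^ ((1 : ℝ) / (k + 1)) * l := by
    rw [hx, mul_rpow hA.le (by positivity), ← rpow_natCast l, ← rpow_mul hl.le]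
    push_cast
    rw [mul_one_div_cancel hk1, rpow_one]
  have hAA : A ^ ((k : ℝ) / (k + 1)) * A ^ ((1 : ℝ) / (k + 1)) = A := by
    rw [← rpow_add hA, ← add_div, div_self hk1, rpow_one]
  have hx0 : 0 < x := by rw [hx]; positivity
  have hexp : (k + 1) * A ^ ((k : ℝ) / (k + 1)) * x ^ ((1 : ℝ) / (k + 1)) = (A + k * A) * l := by
    rw [hpow]
    linear_combination (k + 1) * l * hAA
  rw [hexp]
  have hlogx : log x = log A + (k + 1) * log l := by
    rw [hx, log_mul hA.ne' (by positivity), log_pow]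
    push_cast
    rfl
  have hq : 0 < 1 + 1 / (k : ℝ) := by positivity
  have key : (2 * π * l) ^ (-((k : ℝ) / 2)) *
        (√(2 * π / ((1 + 1 / (k : ℝ)) * A)) / (2 * π * (√l * l ^ k))) =
      A ^ ((k : ℝ) / (k + 1)) / ((2 * π) ^ (((k : ℝ) + 1) / 2) * √(1 + 1 / (k : ℝ))) /
        x ^ ((3 * (k : ℝ) + 1) / (2 * k + 2)) := by
    have h2 : 0 < 2 * π := by positivity
    generalize 2 * π = p at h2 ⊢
    generalize 1 + 1 / (k : ℝ) = q at hq ⊢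
    refine log_injOn_pos (Set.mem_Ioi.2 (by positivity)) (Set.mem_Ioi.2 (by positivity)) ?_
    rw [log_mul (by positivity) (by positivity), log_div (by positivity) (by positivity),
      log_div (by positivity) (by positivity), log_div (by positivity) (by positivity),
      log_mul (by positivity) (by positivity), log_mul (by positivity) (by positivity),
      log_mul (by positivity) (by positivity), log_rpow (by positivity), log_rpow (by positivity),
      log_rpow (by positivity), log_rpow (by positivity), log_sqrt (by positivity),
      log_sqrt (by positivity), log_sqrt (by positivity), log_mul (by positivity) (by positivity),
      log_div (by positivity) (by positivity), log_mul (by positivity) (by positivity), log_pow,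
      hlogx]
    field_simp
    ring
  linear_combination exp ((A + k * A) * l) * key

theorem pk_eq_saddle {k : ℕ} (hk : 1 ≤ k) {A l : ℝ} {n : ℕ} (hl : 0 < l)
    (hn : (n : ℝ) = A * l ^ (k + 1)) :
    (pk k n : ℝ) = exp (A * l) * exp (gridSum k 0 l) * ((∫ u in (-(π * (√l * l ^ k)))..(π * (√l * l ^ k)),
      Complex.exp (gridPhase k l (u / √l)) * Complex.exp
        ((A * l * (u / √l) : ℝ) * Complex.I)).re / (2 * π * (√l * l ^ k))) := by
  have hs0 : 0 < √l := sqrt_pos.2 hl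
  set R := √l * l ^ k with hR
  have hR0 : 0 < R := by positivity
  have h := pk_mul_exp_eq_integral hk n hl
  have hsub : (∫ u in (-(π * R))..(π * R),
      Complex.exp (gridPhase k l (u / √l)) * Complex.exp ((A * l * (u / √l) : ℝ) * Complex.I)) =
      R • ∫ t in (-π)..π, Complex.exp (gridPhase k l (t * l ^ k)) *
        Complex.exp (n * t * Complex.I) := by
    have h1 := intervalIntegral.integral_comp_div (a := -(π * R)) (b := π * R)
      (fun t : ℝ => Complex.exp (gridPhase k l (t * l ^ k)) *
        Complex.exp (n * t * Complex.I)) hR0.ne'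
    rw [neg_div, mul_div_cancel_right₀ _ hR0.ne'] at h1
    rw [← h1]
    refine intervalIntegral.integral_congr fun u _ => ?_
    have e1 : u / R * l ^ k = u / √l := by
      rw [hR]
      field_simp
    have e2 : A * l * (u / √l) = n * (u / R) := by
      rw [hn, hR]
      field_simp
      ring
    simp only [e1, e2]
    push_cast
    rfl
  have hre := congrArg Complex.re h
  rw [hsub, Complex.smul_re]
  have hnl : (n : ℝ) * (l ^ k)⁻¹ = A * l := by
    rw [hn]
    field_simp
    ring
  rw [hnl] at hre
  have hre' : 2 * π * (pk k n * exp (-(A * l))) = exp (gridSum k 0 l) *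
      (∫ t in (-π)..π, Complex.exp (gridPhase k l (t * l ^ k)) *
        Complex.exp (n * t * Complex.I)).re := by
    rw [← Complex.re_ofReal_mul, ← hre, ← Complex.ofReal_re (2 * π * (pk k n * exp (-(A * l))))]
    push_cast
    rfl
  rw [exp_neg] at hre'
  have he := exp_pos (A * l)
  rw [smul_eq_mul]
  generalize (∫ t in (-π)..π, Complex.exp (gridPhase k l (t * l ^ k)) *
    Complex.exp (n * t * Complex.I)).re = I at hre' ⊢
  field_simp at hre' ⊢
  linear_combination hre'

theorem integral_lambertSum_one_pow {k : ℕ} (hk : 1 ≤ k) :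
    ∫ x in Set.Ioi (0 : ℝ), lambertSum 1 (x ^ k) =
      (k : ℝ)⁻¹ * (riemannZeta (1 + 1 / (k : ℂ))).re * Gamma (1 + 1 / (k : ℝ)) := by
  rw [integral_lambertSum_pow hk]
  push_cast
  ring

theorem integral_lambertSum_one_pow_pos {k : ℕ} (hk : 1 ≤ k) :
    0 < ∫ x in Set.Ioi (0 : ℝ), lambertSum 1 (x ^ k) := by
  rw [integral_lambertSum_one_pow hk]
  have h1 := riemannZeta_re_pos hk
  have h2 : 0 < Gamma (1 + 1 / (k : ℝ)) := Gamma_pos_of_pos (by positivity)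
  have hk0 : (0 : ℝ) < k := by exact_mod_cast hk
  positivity

theorem integral_lambertSum_zero_pow {k : ℕ} (hk : 1 ≤ k) :
    ∫ x in Set.Ioi (0 : ℝ), lambertSum 0 (x ^ k) =
      k * ∫ x in Set.Ioi (0 : ℝ), lambertSum 1 (x ^ k) := by
  have hk0 : (0 : ℝ) < k := by exact_mod_cast hk
  rw [integral_lambertSum_one_pow hk, integral_lambertSum_pow hk, add_comm (1 : ℝ) (1 / (k : ℝ)),
    Gamma_add_one (by positivity), Nat.cast_zero, zero_add]
  field_simp

theorem integral_lambertSum_two_pow {k : ℕ} (hk : 1 ≤ k) :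
    ∫ x in Set.Ioi (0 : ℝ), lambertSum 2 (x ^ k) =
      (1 + 1 / (k : ℝ)) * ∫ x in Set.Ioi (0 : ℝ), lambertSum 1 (x ^ k) := by
  rw [integral_lambertSum_one_pow hk, integral_lambertSum_pow hk,
    show ((2 : ℕ) : ℝ) + 1 / (k : ℝ) = (1 + 1 / (k : ℝ)) + 1 by push_cast; ring,
    Gamma_add_one (by positivity)]
  ring

theorem pk_asymptotic (k : ℕ) (hk : 1 ≤ k) :
    Tendsto (fun n : ℕ =>
        (pk k n : ℝ) /
          (bk k * Real.exp (ck k * (n : ℝ) ^ ((1 : ℝ) / (k + 1))) /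
            (n : ℝ) ^ ((3 * (k : ℝ) + 1) / (2 * k + 2))))
      atTop (𝓝 1) := by
  have hA := integral_lambertSum_one_pow_pos hk
  have hB : 0 < ∫ x in Set.Ioi 0, lambertSum 2 (x ^ k) := by
    rw [integral_lambertSum_two_pow hk]
    positivity
  have hJ := tendsto_integral_exp_gridPhase hk hB
  have hS := tendsto_gridSum_zero_sub hk
  have hak : ak k = (∫ x in Set.Ioi (0 : ℝ), lambertSum 1 (x ^ k)) ^ ((k : ℝ) / (k + 1)) := by
    rw [integral_lambertSum_one_pow hk, ak]
  rw [integral_lambertSum_two_pow hk] at hJ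
  rw [integral_lambertSum_zero_pow hk] at hS
  generalize ∫ x in Set.Ioi 0, lambertSum 1 (x ^ k) = A at *
  set D := √(2 * π / ((1 + 1 / (k : ℝ)) * A)) with hD
  have hD0 : 0 < D := by
    have := pi_pos
    positivity
  set J : ℝ → ℂ := fun l => ∫ u in (-(π * (√l * l ^ k)))..(π * (√l * l ^ k)),
    Complex.exp (gridPhase k l (u / √l)) *
      Complex.exp ((A * l * (u / √l) : ℝ) * Complex.I) with hJdef
  have hJre : Tendsto (fun l => (J l).re / D) atTop (𝓝 1) := by
    have h := ((Complex.continuous_re.tendsto _).comp hJ).div_const D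
    rw [Complex.ofReal_re, div_self hD0.ne'] at h
    exact h
  have hmain := ((continuous_exp.tendsto _).comp hS).mul hJre
  rw [exp_zero, mul_one] at hmain
  have hk1 : (k : ℝ) + 1 ≠ 0 := by positivity
  have htop : Tendsto (fun n : ℕ => ((n : ℝ) / A) ^ ((1 : ℝ) / (k + 1))) atTop atTop :=
    (tendsto_rpow_atTop (by positivity)).comp
      (tendsto_natCast_atTop_atTop.atTop_div_const hA)
  refine (hmain.comp htop).congr' ?_
  filter_upwards [eventually_gt_atTop 0] with n hn
  have hn0 : (0 : ℝ) < n := by exact_mod_cast hn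
  simp only [Function.comp_apply]
  set l := ((n : ℝ) / A) ^ ((1 : ℝ) / (k + 1)) with hl
  have hl0 : 0 < l := by positivity
  have hnl : (n : ℝ) = A * l ^ (k + 1) := by
    rw [hl, ← rpow_natCast, ← rpow_mul (by positivity)]
    push_cast
    rw [one_div_mul_cancel hk1, rpow_one]
    field_simp
  rw [ck, bk, hak, ← saddle_main_term_eq hk hA hl0 hnl, pk_eq_saddle hk hl0 hnl]
  change _ = exp (A * l) * exp (gridSum k 0 l) * ((J l).re / _) / _
  have hpow : (2 * π * l) ^ (-((k : ℝ) / 2)) = exp (-(k / 2 * log (2 * π * l))) := by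
    rw [rpow_def_of_pos (by positivity)]
    congr 1
    ring
  rw [hpow, ← hD]
  have hexp : exp (A * l) * exp (gridSum k 0 l) =
      exp (gridSum k 0 l - l * (k * A) + k / 2 * log (2 * π * l)) *
        (exp ((A + k * A) * l) * exp (-(k / 2 * log (2 * π * l)))) := by
    rw [← exp_add, ← exp_add, ← exp_add]
    congr 1
    ring
  rw [hexp]
  have hs0 : 0 < √l := sqrt_pos.2 hl0
  field_simp
end

section
/- p(n) ~ exp(π√(2n/3)) / (4√3 · n) as n → ∞, where p(n) is the number of unrestricted partitions of n. -/
open Real Filter Topology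

/-- The Euler function `∏ (1 - q ^ n)`, the reciprocal of the partition generating function. -/
noncomputable def eulerProduct (q : ℂ) : ℂ := ∏' n : ℕ, (1 - q ^ (n + 1))

/-- The Taylor series of a function at `0`, as a formal power series. -/
noncomputable def taylorSeries (f : ℂ → ℂ) : PowerSeries ℂ :=
  PowerSeries.mk fun n => iteratedDeriv n f 0 / n.factorial

theorem taylorSeries_mul {f g : ℂ → ℂ} (hf : AnalyticAt ℂ f 0) (hg : AnalyticAt ℂ g 0) :
    taylorSeries (f * g) = taylorSeries f * taylorSeries g := by
  ext n
  rw [PowerSeries.coeff_mul, Finset.Nat.sum_antidiagonal_eq_sum_range_succ_mk]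
  simp only [taylorSeries, PowerSeries.coeff_mk]
  rw [iteratedDeriv_mul hf.contDiffAt hg.contDiffAt, Finset.sum_div]
  refine Finset.sum_congr rfl fun i hi => ?_
  have hin : i ≤ n := Nat.lt_succ_iff.mp (Finset.mem_range.mp hi)
  rw [Nat.cast_choose ℂ hin]
  have h1 : (n.factorial : ℂ) ≠ 0 := mod_cast n.factorial_ne_zero
  have h2 : (i.factorial : ℂ) ≠ 0 := mod_cast i.factorial_ne_zero
  have h3 : ((n - i).factorial : ℂ) ≠ 0 := mod_cast (n - i).factorial_ne_zero
  field_simp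

theorem taylorSeries_one : taylorSeries 1 = 1 := by
  ext n
  have : (1 : ℂ → ℂ) = fun _ => 1 := rfl
  simp only [taylorSeries, PowerSeries.coeff_mk, PowerSeries.coeff_one, this, iteratedDeriv_const]
  split_ifs with h <;> simp [h]

theorem taylorSeries_one_sub_pow {k : ℕ} (hk : k ≠ 0) :
    taylorSeries (fun q => 1 - q ^ k) = 1 - PowerSeries.X ^ k := by
  ext n
  simp only [taylorSeries, PowerSeries.coeff_mk, map_sub, PowerSeries.coeff_one,
    PowerSeries.coeff_X_pow]
  rw [iteratedDeriv_fun_sub contDiffAt_const (by fun_prop), iteratedDeriv_const,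
    iteratedDeriv_fun_pow_zero]
  rcases eq_or_ne n 0 with rfl | hn
  · simp [hk.symm]
  · rcases eq_or_ne n k with rfl | hnk
    · have : (n.factorial : ℂ) ≠ 0 := mod_cast n.factorial_ne_zero
      simp [hn, neg_div, div_self this]
    · simp [hn, hnk]

theorem taylorSeries_prod_one_sub_pow (s : Finset ℕ) :
    taylorSeries (fun q => ∏ i ∈ s, (1 - q ^ (i + 1))) =
      ∏ i ∈ s, (1 - PowerSeries.X ^ (i + 1)) := by
  induction s using Finset.induction_on with
  | empty =>
    simp only [Finset.prod_empty]
    exact taylorSeries_one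
  | insert i s hi ih =>
    rw [Finset.prod_insert hi, ← ih, ← taylorSeries_one_sub_pow i.succ_ne_zero,
      ← taylorSeries_mul (by fun_prop) (by fun_prop)]
    simp [Finset.prod_insert hi, Pi.mul_def]

theorem tendsto_iteratedDeriv {ι : Type*} {φ : Filter ι} {F : ι → ℂ → ℂ} {f : ℂ → ℂ} {U : Set ℂ}
    (hf : TendstoLocallyUniformlyOn F f φ U) (hF : ∀ i, DifferentiableOn ℂ (F i) U)
    (hU : IsOpen U) (n : ℕ) :
    TendstoLocallyUniformlyOn (fun i => iteratedDeriv n (F i)) (iteratedDeriv n f) φ U ∧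
      ∀ i, DifferentiableOn ℂ (iteratedDeriv n (F i)) U := by
  induction n with
  | zero => simpa using ⟨hf, hF⟩
  | succ n ih =>
    simp only [iteratedDeriv_succ]
    exact ⟨ih.1.deriv (.of_forall ih.2) hU, fun i => (ih.2 i).deriv hU⟩

theorem differentiableOn_eulerProduct : DifferentiableOn ℂ eulerProduct (Metric.ball 0 1) :=
  ModularForm.differentiableOn_tprod_one_sub_pow

theorem analyticAt_eulerProduct : AnalyticAt ℂ eulerProduct 0 :=
  differentiableOn_eulerProduct.analyticAt (Metric.ball_mem_nhds 0 one_pos)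

theorem taylorSeries_eulerProduct :
    taylorSeries eulerProduct = PowerSeries.pentagonalSeries ℂ := by
  ext n
  rw [taylorSeries, PowerSeries.coeff_mk]
  have h := (tendsto_iteratedDeriv
    ModularForm.multipliableLocallyUniformlyOn_one_sub_pow.hasProdLocallyUniformlyOn
    (fun s => by fun_prop) Metric.isOpen_ball n).1.tendsto_at
      (Metric.mem_ball_self (x := (0 : ℂ)) one_pos)
  have h' := h.div_const (n.factorial : ℂ)
  refine tendsto_nhds_unique h' (tendsto_nhds_of_eventually_eq ?_)
  filter_upwards [PowerSeries.coeff_prod_one_sub_X_pow_eventually_eq ℂ n] with s hs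
  rw [← hs, ← taylorSeries_prod_one_sub_pow, taylorSeries, PowerSeries.coeff_mk]

open PowerSeries PowerSeries.WithPiTopology in
theorem mk_card_partition_mul_pentagonalSeries :
    (PowerSeries.mk fun n => (Nat.card (Nat.Partition n) : ℂ)) * PowerSeries.pentagonalSeries ℂ
      = 1 := by
  have h1 := Nat.Partition.hasProd_powerSeriesMk_card_restricted ℂ (fun _ => True)
  have h2 := h1.mul (hasProd_one_sub_X_pow ℂ)
  have h3 : (fun n => (Nat.card (Nat.Partition n) : ℂ)) =
      fun n => ((Nat.Partition.restricted n (fun _ => True)).card : ℂ) := by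
    ext n
    simp [Nat.Partition.restricted, Nat.card_eq_fintype_card]
  rw [h3]
  refine h2.unique ?_
  simp only [if_true, pow_mul]
  conv in fun b ↦ _ =>
    ext b
    rw [tsum_pow_mul_one_sub_of_constantCoeff_eq_zero (by simp)]
  exact hasProd_one

theorem eulerProduct_ne_zero {q : ℂ} (hq : ‖q‖ < 1) : eulerProduct q ≠ 0 := by
  have := tprod_one_add_ne_zero_of_summable (f := fun n : ℕ => -q ^ (n + 1)) ?_ ?_
  · simpa [eulerProduct, sub_eq_add_neg] using this
  · intro i h
    have h1 : q ^ (i + 1) = 1 := by linear_combination -h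
    have h2 : ‖q‖ ^ (i + 1) < 1 := pow_lt_one₀ (norm_nonneg _) hq i.succ_ne_zero
    rw [← norm_pow, h1, norm_one] at h2
    exact lt_irrefl _ h2
  · simpa using (summable_nat_add_iff 1).mpr (summable_geometric_of_lt_one (norm_nonneg _) hq)

theorem differentiableOn_inv_eulerProduct :
    DifferentiableOn ℂ (fun q => (eulerProduct q)⁻¹) (Metric.ball 0 1) :=
  differentiableOn_eulerProduct.inv fun q hq => eulerProduct_ne_zero (by simpa using hq)

theorem card_partition_eq_iteratedDeriv (n : ℕ) :
    (Nat.card (Nat.Partition n) : ℂ) =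
      iteratedDeriv n (fun q => (eulerProduct q)⁻¹) 0 / n.factorial := by
  have h1 : taylorSeries ((fun q => (eulerProduct q)⁻¹) * eulerProduct) = 1 := by
    rw [← taylorSeries_one]
    ext m
    simp only [taylorSeries, PowerSeries.coeff_mk]
    congr 1
    refine Filter.EventuallyEq.iteratedDeriv_eq _ ?_
    filter_upwards [Metric.ball_mem_nhds (0 : ℂ) one_pos] with q hq
    exact inv_mul_cancel₀ (eulerProduct_ne_zero (by simpa using hq))
  rw [taylorSeries_mul (differentiableOn_inv_eulerProduct.analyticAt
    (Metric.ball_mem_nhds 0 one_pos)) analyticAt_eulerProduct, taylorSeries_eulerProduct] at h1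
  have h2 := mk_card_partition_mul_pentagonalSeries
  have h3 : (PowerSeries.mk fun n => (Nat.card (Nat.Partition n) : ℂ)) =
      taylorSeries (fun q => (eulerProduct q)⁻¹) :=
    left_inv_eq_right_inv h2 (by rw [mul_comm]; exact h1)
  simpa [taylorSeries] using congrArg (PowerSeries.coeff n) h3

theorem card_partition_eq_integral (n : ℕ) {t : ℝ} (ht : 0 < t) :
    (Nat.card (Nat.Partition n) : ℂ) = (2 * π : ℂ)⁻¹ * ∫ θ in (-π)..π,
      Complex.exp (n * (t - θ * Complex.I)) *
        (eulerProduct (Complex.exp (-(t - θ * Complex.I))))⁻¹ := by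
  have hr : Real.exp (-t) < 1 := by simpa using ht
  have h := (differentiableOn_inv_eulerProduct.mono
    (Metric.closedBall_subset_ball hr)).circleIntegral_one_div_sub_center_pow_smul
      (Real.exp_pos _) n
  have hper : Function.Periodic (fun θ : ℝ => Complex.exp (n * (t - θ * Complex.I)) *
        (eulerProduct (Complex.exp (-(t - θ * Complex.I))))⁻¹) (2 * π) := by
    intro θ
    have e1 : Complex.exp (n * (t - (θ + 2 * π : ℝ) * Complex.I)) =
        Complex.exp (n * (t - θ * Complex.I)) :=
      Complex.exp_eq_exp_iff_exists_int.mpr ⟨-n, by push_cast; ring⟩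
    have e2 : Complex.exp (-(t - (θ + 2 * π : ℝ) * Complex.I)) =
        Complex.exp (-(t - θ * Complex.I)) :=
      Complex.exp_eq_exp_iff_exists_int.mpr ⟨1, by push_cast; ring⟩
    simp only [e1, e2]
  have hshift := hper.intervalIntegral_add_eq (-π) 0
  rw [show -π + 2 * π = π by ring, zero_add] at hshift
  rw [hshift, card_partition_eq_iteratedDeriv]
  have hI : (2 * π * Complex.I) ≠ 0 := Complex.two_pi_I_ne_zero
  have h2 : iteratedDeriv n (fun q => (eulerProduct q)⁻¹) 0 / n.factorial =
      (2 * π * Complex.I)⁻¹ * ((2 * π * Complex.I / n.factorial) •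
        iteratedDeriv n (fun q => (eulerProduct q)⁻¹) 0) := by
    rw [smul_eq_mul]
    field_simp
  rw [h2, ← h, circleIntegral, mul_inv, mul_assoc, ← intervalIntegral.integral_const_mul]
  congr 1
  refine intervalIntegral.integral_congr fun θ _ => ?_
  have hz : circleMap 0 (Real.exp (-t)) θ = Complex.exp (-(t - θ * Complex.I)) := by
    rw [circleMap, zero_add, Complex.ofReal_exp, ← Complex.exp_add]
    congr 1
    push_cast
    ring
  simp only [deriv_circleMap, hz, sub_zero, smul_eq_mul]
  rw [pow_succ, ← Complex.exp_nat_mul, show (n : ℂ) * -(t - θ * Complex.I) =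
    -(n * (t - θ * Complex.I)) by ring, Complex.exp_neg (n * _)]
  have := Complex.exp_ne_zero (-(t - θ * Complex.I))
  have := Complex.exp_ne_zero (n * (t - θ * Complex.I))
  field_simp [Complex.I_ne_zero]

theorem complex_sqrt_sq (x : ℂ) : Complex.sqrt x ^ 2 = x := by
  simp [Complex.sqrt]

theorem complex_sqrt_ofReal_mul {r : ℝ} (hr : 0 < r) {x : ℂ} (hx : x ≠ 0) :
    Complex.sqrt (r * x) = √r * Complex.sqrt x := by
  have hr' : (r : ℂ) ≠ 0 := mod_cast hr.ne'
  rw [sqrt_eq_exp (mul_ne_zero hr' hx), sqrt_eq_exp hx, Complex.log_ofReal_mul hr hx, add_div,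
    Complex.exp_add, Real.sqrt_eq_rpow, Real.rpow_def_of_pos hr]
  push_cast
  ring_nf

/-- The square root of `w`, for the branch arising in the inversion formula for `η`. -/
noncomputable def etaFactor (w : ℂ) : ℂ := (Complex.sqrt Complex.I)⁻¹ * Complex.sqrt (Complex.I * w)

theorem norm_etaFactor_sq (w : ℂ) : ‖etaFactor w‖ ^ 2 = ‖w‖ := by
  rw [← norm_pow, etaFactor, mul_pow, inv_pow, complex_sqrt_sq, complex_sqrt_sq]
  simp

theorem tendsto_etaFactor : Tendsto etaFactor (𝓝 1) (𝓝 1) := by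
  have h0 : Complex.sqrt Complex.I ≠ 0 := fun h => by
    have := complex_sqrt_sq Complex.I
    rw [h] at this
    simp [eq_comm] at this
  have h1 : ContinuousAt etaFactor 1 := by
    refine continuousAt_const.mul (ContinuousAt.comp (g := Complex.sqrt) ?_ (by fun_prop))
    exact (Complex.differentiableAt_sqrt (by simp [Complex.mem_slitPlane_iff])).continuousAt
  have h2 : etaFactor 1 = 1 := by simp [etaFactor, h0]
  simpa [ContinuousAt, h2] using h1

theorem inv_eulerProduct_exp_neg {t : ℝ} (ht : 0 < t) {w : ℂ} (hw : 0 < w.re) :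
    (eulerProduct (Complex.exp (-(t * w))))⁻¹ =
      √(t / (2 * π)) * etaFactor w * Complex.exp (-(t * w) / 24 + π ^ 2 / (6 * (t * w))) *
        (eulerProduct (Complex.exp (-(4 * π ^ 2 / (t * w)))))⁻¹ := by
  have hw0 : w ≠ 0 := fun h => by simp [h] at hw
  have ht0 : (t : ℂ) ≠ 0 := mod_cast ht.ne'
  have hpi : (π : ℂ) ≠ 0 := mod_cast Real.pi_ne_zero
  have hI := Complex.I_ne_zero
  set τ : ℂ := (t / (2 * π) : ℝ) * (Complex.I * w) with hτ
  have hτim : τ ∈ UpperHalfPlane.upperHalfPlaneSet := by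
    change 0 < τ.im
    rw [hτ, Complex.im_ofReal_mul]
    simp only [Complex.mul_im, Complex.I_re, Complex.I_im, zero_mul, one_mul, zero_add]
    positivity
  have key := ModularForm.eta_comp_eq_csqrt_I_inv hτim
  have eta_eq (x : ℂ) : ModularForm.eta x =
      Complex.exp (2 * π * Complex.I * x / 24) *
        eulerProduct (Complex.exp (2 * π * Complex.I * x)) := by
    simp [ModularForm.eta, eulerProduct, ModularForm.eta_q_eq_pow, Function.Periodic.qParam]
  have e1 : 2 * π * Complex.I * τ = -(t * w) := by
    rw [hτ]
    push_cast
    field_simp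
    simp
  have e2 : 2 * π * Complex.I * (-1 / τ) = -(4 * π ^ 2 / (t * w)) := by
    rw [hτ]
    push_cast
    field_simp
    ring
  simp only [Function.comp_apply, Pi.smul_apply, Pi.mul_apply, smul_eq_mul, eta_eq, e1, e2] at key
  rw [hτ, complex_sqrt_ofReal_mul (by positivity) (mul_ne_zero hI hw0)] at key
  have n1 : ‖Complex.exp (-(t * w))‖ < 1 := by
    rw [Complex.norm_exp]
    simpa using mul_pos ht hw
  have n2 : ‖Complex.exp (-(4 * π ^ 2 / (t * w)))‖ < 1 := by
    rw [← e2, mul_comm (2 * (π : ℂ)) _, mul_assoc, mul_comm]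
    have := UpperHalfPlane.norm_exp_two_pi_I_lt_one
      (.mk _ (UpperHalfPlane.im_inv_neg_coe_pos ⟨τ, hτim⟩))
    convert this using 3
    simp [neg_div]
    ring
  have z1 := eulerProduct_ne_zero n1
  have z2 := eulerProduct_ne_zero n2
  have e3 : Complex.exp (-(t * w) / 24 + π ^ 2 / (6 * (t * w))) =
      Complex.exp (-(t * w) / 24) * (Complex.exp (-(4 * π ^ 2 / (t * w)) / 24))⁻¹ := by
    rw [← Complex.exp_neg, ← Complex.exp_add]
    congr 1
    field_simp
    ring
  have z3 := Complex.exp_ne_zero (-(4 * π ^ 2 / (t * w)) / 24)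
  rw [e3, etaFactor]
  generalize (Complex.sqrt Complex.I)⁻¹ = c at key ⊢
  generalize Complex.exp (-(4 * π ^ 2 / (t * w)) / 24) = a at key z3 ⊢
  generalize eulerProduct (Complex.exp (-(4 * π ^ 2 / (t * w)))) = P at key z2 ⊢
  generalize Complex.exp (-(t * w) / 24) = b at key ⊢
  generalize Complex.sqrt (Complex.I * w) = s at key ⊢
  field_simp
  linear_combination key

theorem tendsto_eulerProduct : Tendsto eulerProduct (𝓝 0) (𝓝 1) := by
  simpa [ContinuousAt, eulerProduct] using analyticAt_eulerProduct.continuousAt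

theorem one_sub_norm_mul_exp_le {w : ℂ} (hw : ‖w‖ < 1) :
    (1 - ‖w‖) * Real.exp ((‖w‖ - w.re) / 4) ≤ ‖1 - w‖ := by
  have h1 : w.re ≤ ‖w‖ := Complex.re_le_norm w
  have h2 : -‖w‖ ≤ w.re := (abs_le.mp (Complex.abs_re_le_norm w)).1
  have h3 : Real.exp ((‖w‖ - w.re) / 2) ≤ 1 + (‖w‖ - w.re) := by
    have := abs_le.mp (Real.abs_exp_sub_one_le (x := (‖w‖ - w.re) / 2)
      (by rw [abs_le]; constructor <;> linarith))
    rw [abs_of_nonneg (by linarith : 0 ≤ (‖w‖ - w.re) / 2)] at this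
    linarith [this.2]
  have h4 : ‖1 - w‖ ^ 2 = (1 - ‖w‖) ^ 2 + 2 * (‖w‖ - w.re) := by
    have := Complex.sq_norm w
    rw [Complex.normSq_apply] at this
    rw [Complex.sq_norm, Complex.normSq_apply]
    simp
    linear_combination -this
  refine le_of_sq_le_sq ?_ (norm_nonneg _)
  rw [h4, mul_pow, ← Real.exp_nat_mul, show ((2 : ℕ) : ℝ) * ((‖w‖ - w.re) / 4) =
    (‖w‖ - w.re) / 2 by push_cast; ring]
  have h5 : (1 - ‖w‖) ^ 2 ≤ 1 := by nlinarith [norm_nonneg w]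
  calc (1 - ‖w‖) ^ 2 * Real.exp ((‖w‖ - w.re) / 2)
      ≤ (1 - ‖w‖) ^ 2 * (1 + (‖w‖ - w.re)) := by gcongr
    _ ≤ _ := by nlinarith

theorem norm_eulerProduct_mul_exp_le {q : ℂ} (hq : ‖q‖ < 1) :
    ‖eulerProduct ‖q‖‖ * Real.exp ((‖q‖ / (1 - ‖q‖) - (q / (1 - q)).re) / 4) ≤
      ‖eulerProduct q‖ := by
  have hq' : ‖((‖q‖ : ℝ) : ℂ)‖ < 1 := by simpa using hq
  have hP (x : ℂ) (hx : ‖x‖ < 1) :=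
    ((ModularForm.multipliable_one_sub_pow hx).hasProd.tendsto_prod_nat).norm
  have hs (x : ℂ) (hx : ‖x‖ < 1) : HasSum (fun n : ℕ => x ^ (n + 1)) (x / (1 - x)) := by
    simpa [pow_succ, div_eq_inv_mul] using (hasSum_geometric_of_norm_lt_one hx).mul_right x
  have h1 := ((Complex.hasSum_re (hs _ hq')).sub (Complex.hasSum_re (hs q hq))).tendsto_sum_nat
  have h2 := (Real.continuous_exp.tendsto _).comp (h1.div_const 4)
  have e : ((((‖q‖ : ℝ) : ℂ) / (1 - ((‖q‖ : ℝ) : ℂ)))).re = ‖q‖ / (1 - ‖q‖) := by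
    rw [← Complex.ofReal_one, ← Complex.ofReal_sub, ← Complex.ofReal_div, Complex.ofReal_re]
  rw [e] at h2
  refine le_of_tendsto_of_tendsto' ((hP _ hq').mul h2) (hP q hq) fun N => ?_
  simp only [Function.comp_apply, Finset.sum_div, Real.exp_sum, norm_prod]
  rw [← Finset.prod_mul_distrib]
  refine Finset.prod_le_prod (fun i _ => by positivity) fun i _ => ?_
  have hi : ‖q ^ (i + 1)‖ < 1 := by
    rw [norm_pow]
    exact pow_lt_one₀ (norm_nonneg _) hq i.succ_ne_zero
  have a : ‖1 - ((‖q‖ : ℝ) : ℂ) ^ (i + 1)‖ = 1 - ‖q ^ (i + 1)‖ := by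
    rw [← Complex.ofReal_pow, ← Complex.ofReal_one, ← Complex.ofReal_sub, Complex.norm_real,
      ← norm_pow, Real.norm_of_nonneg (by linarith)]
  have b : (((‖q‖ : ℝ) : ℂ) ^ (i + 1)).re = ‖q ^ (i + 1)‖ := by
    rw [← Complex.ofReal_pow, Complex.ofReal_re, norm_pow]
  rw [a, b]
  exact one_sub_norm_mul_exp_le hi

/-- The point `1 - √t u i` on the line of integration, as seen from the saddle point `1`. -/
noncomputable def saddlePoint (t u : ℝ) : ℂ := 1 - √t * u * Complex.I

theorem saddlePoint_re (t u : ℝ) : (saddlePoint t u).re = 1 := by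
  simp [saddlePoint]

theorem saddlePoint_ne_zero (t u : ℝ) : saddlePoint t u ≠ 0 := fun h => by
  simpa [h] using saddlePoint_re t u

theorem normSq_saddlePoint {t : ℝ} (ht : 0 < t) (u : ℝ) :
    Complex.normSq (saddlePoint t u) = 1 + t * u ^ 2 := by
  rw [Complex.normSq_apply]
  simp only [saddlePoint, Complex.sub_re, Complex.sub_im, Complex.one_re, Complex.one_im,
    Complex.mul_re, Complex.mul_im, Complex.I_re, Complex.I_im, Complex.ofReal_re,
    Complex.ofReal_im]
  linear_combination u ^ 2 * Real.sq_sqrt ht.le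

theorem re_div_saddlePoint {t : ℝ} (ht : 0 < t) (u c : ℝ) :
    (c / saddlePoint t u).re = c / (1 + t * u ^ 2) := by
  rw [Complex.div_re, normSq_saddlePoint ht, saddlePoint_re]
  simp

/-- The integrand of the Cauchy integral for the partition numbers, rescaled about its
saddle point. -/
noncomputable def scaledIntegrand (t u : ℝ) : ℂ :=
  ((√t)⁻¹ * Real.exp (-(π ^ 2 / (3 * t))) : ℝ) *
    Complex.exp ((π ^ 2 / (6 * t) : ℝ) * saddlePoint t u) *
      (eulerProduct (Complex.exp (-(t * saddlePoint t u))))⁻¹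

theorem scaledIntegrand_eq {t : ℝ} (ht : 0 < t) (u : ℝ) :
    scaledIntegrand t u =
      (√(2 * π))⁻¹ * etaFactor (saddlePoint t u) *
        Complex.exp (-((π ^ 2 * u ^ 2 / 6 : ℝ) / saddlePoint t u)
          - (t / 24 : ℝ) * saddlePoint t u) *
        (eulerProduct (Complex.exp (-((4 * π ^ 2 / t : ℝ) / saddlePoint t u))))⁻¹ := by
  have hs : (√t : ℂ) ≠ 0 := mod_cast (Real.sqrt_pos.mpr ht).ne'
  have hs2 : (√t : ℂ) ^ 2 = t := mod_cast Real.sq_sqrt ht.le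
  have ht0 : (t : ℂ) ≠ 0 := mod_cast ht.ne'
  have hw := saddlePoint_ne_zero t u
  have h2 : (√(2 * π) : ℂ) ≠ 0 := mod_cast (Real.sqrt_pos.mpr (by positivity)).ne'
  have hE : Complex.exp (-((π ^ 2 * u ^ 2 / 6 : ℝ) / saddlePoint t u)
      - (t / 24 : ℝ) * saddlePoint t u) =
      Complex.exp (-(π ^ 2 / (3 * t))) *
        Complex.exp ((π ^ 2 / (6 * t) : ℝ) * saddlePoint t u) *
        Complex.exp (-(t * saddlePoint t u) / 24 + π ^ 2 / (6 * (t * saddlePoint t u))) := by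
    rw [← Complex.exp_add, ← Complex.exp_add]
    congr 1
    have hu : (saddlePoint t u - 1) ^ 2 = -t * u ^ 2 := by
      rw [saddlePoint, ← hs2]
      linear_combination (√t : ℂ) ^ 2 * u ^ 2 * Complex.I_sq
    push_cast
    field_simp
    linear_combination (-72 * π ^ 2 : ℂ) * hu
  rw [scaledIntegrand, inv_eulerProduct_exp_neg ht (by rw [saddlePoint_re]; exact one_pos), hE,
    Real.sqrt_div ht.le]
  have h4 : (4 * π ^ 2 / (t * saddlePoint t u) : ℂ) =
      (4 * π ^ 2 / t : ℝ) / saddlePoint t u := by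
    push_cast
    field_simp
  rw [h4]
  push_cast
  field_simp

theorem tendsto_saddlePoint (u : ℝ) : Tendsto (saddlePoint · u) (𝓝[>] 0) (𝓝 1) := by
  have : Continuous (saddlePoint · u) := by
    unfold saddlePoint
    fun_prop
  simpa [saddlePoint] using (this.tendsto 0).mono_left nhdsWithin_le_nhds

theorem norm_exp_neg_div_saddlePoint_le {t : ℝ} (ht : 0 < t) (u : ℝ) :
    ‖Complex.exp (-((4 * π ^ 2 / t : ℝ) / saddlePoint t u))‖ ≤ t * (1 + t * u ^ 2) / 36 := by
  rw [Complex.norm_exp, Complex.neg_re, re_div_saddlePoint ht, Real.exp_neg]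
  have h1 : (0 : ℝ) < 1 + t * u ^ 2 := by positivity
  have hpi : 9 ≤ π ^ 2 := by nlinarith [Real.pi_gt_three]
  have h2 : 36 / (t * (1 + t * u ^ 2)) ≤ Real.exp (4 * π ^ 2 / t / (1 + t * u ^ 2)) := by
    refine le_trans ?_ (Real.add_one_le_exp _ |>.trans' (le_add_of_nonneg_right zero_le_one))
    rw [div_div]
    gcongr
    linarith
  exact (inv_anti₀ (by positivity) h2).trans_eq (inv_div _ _)

theorem tendsto_scaledIntegrand (u : ℝ) :
    Tendsto (scaledIntegrand · u) (𝓝[>] 0)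
      (𝓝 ((√(2 * π))⁻¹ * Real.exp (-(π ^ 2 / 6) * u ^ 2) : ℝ)) := by
  have h0 : Tendsto (fun t : ℝ => t) (𝓝[>] 0) (𝓝 0) := nhdsWithin_le_nhds
  have hw := tendsto_saddlePoint u
  have hq : Tendsto (fun t : ℝ => Complex.exp (-((4 * π ^ 2 / t : ℝ) / saddlePoint t u)))
      (𝓝[>] 0) (𝓝 0) := by
    refine squeeze_zero_norm' (a := fun t => t * (1 + t * u ^ 2) / 36) ?_ ?_
    · filter_upwards [self_mem_nhdsWithin] with t ht
      exact norm_exp_neg_div_saddlePoint_le ht u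
    · have : Continuous fun t : ℝ => t * (1 + t * u ^ 2) / 36 := by fun_prop
      simpa using (this.tendsto 0).mono_left nhdsWithin_le_nhds
  have hE := (tendsto_eulerProduct.comp hq).inv₀ one_ne_zero
  have hx : Tendsto (fun t : ℝ => -((π ^ 2 * u ^ 2 / 6 : ℝ) / saddlePoint t u)
      - (t / 24 : ℝ) * saddlePoint t u) (𝓝[>] 0) (𝓝 (-((π ^ 2 * u ^ 2 / 6 : ℝ) / 1) - 0 * 1)) := by
    refine ((tendsto_const_nhds.div hw one_ne_zero).neg).sub (Tendsto.mul ?_ hw)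
    simpa [Function.comp_def] using (Complex.continuous_ofReal.tendsto _).comp (h0.div_const 24)
  have h := ((tendsto_const_nhds (x := (((√(2 * π))⁻¹ : ℝ) : ℂ))).mul (tendsto_etaFactor.comp hw)).mul
    ((Complex.continuous_exp.tendsto _).comp hx) |>.mul hE
  have h' := h.congr' (f₂ := (scaledIntegrand · u)) (by
    filter_upwards [self_mem_nhdsWithin] with t ht
    exact (scaledIntegrand_eq ht u).symm)
  convert h' using 2
  push_cast
  simp only [mul_one, inv_one, div_one, sub_zero]
  congr 2
  ring

theorem exists_norm_inv_eulerProduct_le :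
    ∃ ρ > 0, ∀ q : ℂ, ‖q‖ < ρ → ‖(eulerProduct q)⁻¹‖ ≤ 2 := by
  have h := (tendsto_eulerProduct.inv₀ one_ne_zero).norm
  have h' := h.eventually (eventually_le_nhds (b := 2) (by norm_num))
  obtain ⟨ρ, hρ, hb⟩ := Metric.eventually_nhds_iff.mp h'
  exact ⟨ρ, hρ, fun q hq => hb (by simpa using hq)⟩

theorem eventually_norm_scaledIntegrand_le :
    ∀ᶠ t in 𝓝[>] 0, ∀ u : ℝ, t * u ^ 2 ≤ 16 →
      ‖scaledIntegrand t u‖ ≤ 612 * (1 + u ^ 2)⁻¹ := by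
  obtain ⟨ρ, hρ, hb⟩ := exists_norm_inv_eulerProduct_le
  filter_upwards [self_mem_nhdsWithin, nhdsWithin_le_nhds (Iio_mem_nhds hρ)] with t ht htρ u hu
  have ht : 0 < t := ht
  have htρ : t < ρ := htρ
  have hpi : 9 ≤ π ^ 2 := by nlinarith [Real.pi_gt_three]
  have h1 : ‖(((√(2 * π))⁻¹ : ℝ) : ℂ)‖ ≤ 1 := by
    rw [Complex.norm_real, Real.norm_of_nonneg (by positivity)]
    exact inv_le_one_of_one_le₀ (Real.one_le_sqrt.mpr (by linarith [Real.pi_gt_three]))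
  have h2 : ‖etaFactor (saddlePoint t u)‖ ≤ 3 := by
    have e1 := norm_etaFactor_sq (saddlePoint t u)
    have e2 : ‖saddlePoint t u‖ ^ 2 ≤ 17 := by
      rw [← Complex.normSq_eq_norm_sq, normSq_saddlePoint ht]
      linarith
    have e3 : ‖saddlePoint t u‖ ≤ 5 := by nlinarith [norm_nonneg (saddlePoint t u)]
    nlinarith [norm_nonneg (etaFactor (saddlePoint t u))]
  have h3 : ‖Complex.exp (-((π ^ 2 * u ^ 2 / 6 : ℝ) / saddlePoint t u)
      - (t / 24 : ℝ) * saddlePoint t u)‖ ≤ 102 * (1 + u ^ 2)⁻¹ := by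
    rw [Complex.norm_exp, Complex.sub_re, Complex.neg_re, re_div_saddlePoint ht,
      Complex.re_ofReal_mul, saddlePoint_re]
    have e1 : u ^ 2 / 102 ≤ π ^ 2 * u ^ 2 / 6 / (1 + t * u ^ 2) := by
      rw [div_div, div_le_div_iff₀ (by norm_num) (by positivity)]
      nlinarith [mul_nonneg (sq_nonneg u) (sub_nonneg.mpr hpi),
        mul_nonneg (sq_nonneg u) (sub_nonneg.mpr hu)]
    calc Real.exp (-(π ^ 2 * u ^ 2 / 6 / (1 + t * u ^ 2)) - t / 24 * 1)
        ≤ Real.exp (-(u ^ 2 / 102)) := by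
          apply Real.exp_le_exp.mpr
          linarith
      _ ≤ ((1 + u ^ 2) / 102)⁻¹ := by
          rw [Real.exp_neg]
          gcongr
          linarith [Real.add_one_le_exp (u ^ 2 / 102)]
      _ = 102 * (1 + u ^ 2)⁻¹ := by rw [inv_div, div_eq_mul_inv]
  have h4 : ‖(eulerProduct (Complex.exp (-((4 * π ^ 2 / t : ℝ) / saddlePoint t u))))⁻¹‖ ≤ 2 := by
    refine hb _ ((norm_exp_neg_div_saddlePoint_le ht u).trans_lt ?_)
    nlinarith
  rw [scaledIntegrand_eq ht, norm_mul, norm_mul, norm_mul]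
  calc _ ≤ 1 * 3 * (102 * (1 + u ^ 2)⁻¹) * 2 := by gcongr
    _ = _ := by ring

theorem inv_le_sub_re_div_one_sub_exp {t θ : ℝ} (ht : 0 < t) (ht1 : t ≤ 1 / 2) (h1 : 4 * t < |θ|)
    (h2 : |θ| ≤ π) :
    (4 * t)⁻¹ ≤ Real.exp (-t) / (1 - Real.exp (-t)) -
      (Complex.exp (-(t - θ * Complex.I)) / (1 - Complex.exp (-(t - θ * Complex.I)))).re := by
  set q := Complex.exp (-(t - θ * Complex.I)) with hq
  set r := Real.exp (-t) with hr
  have hqr : ‖q‖ = r := by simp [hq, hr, Complex.norm_exp]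
  have hr1 : r < 1 := by simpa [hr] using ht
  have hrt : 1 - r ≤ t := by linarith [Real.add_one_le_exp (-t)]
  have hre : q.re = r * Real.cos θ := by simp [hq, hr, Complex.exp_re]
  have hpi : π ^ 2 ≤ 10 := by nlinarith [Real.pi_lt_d2, Real.pi_gt_three]
  have hcos : θ ^ 2 / 5 ≤ 1 - Real.cos θ := by
    have e1 := Real.cos_le_one_sub_mul_cos_sq h2
    have e2 : (1 / 5 : ℝ) ≤ 2 / π ^ 2 := by
      rw [div_le_div_iff₀ (by norm_num) (by positivity)]
      linarith
    nlinarith [mul_le_mul_of_nonneg_right e2 (sq_nonneg θ)]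
  have hθ : 16 * t ^ 2 ≤ θ ^ 2 := by
    rw [← sq_abs θ]
    nlinarith
  have hn : 2 * (1 - r) ≤ ‖1 - q‖ := by
    refine le_of_sq_le_sq ?_ (norm_nonneg _)
    have e1 : ‖1 - q‖ ^ 2 = (1 - r) ^ 2 + 2 * r * (1 - Real.cos θ) := by
      have := Complex.sq_norm q
      rw [Complex.normSq_apply, hqr] at this
      rw [Complex.sq_norm, Complex.normSq_apply]
      simp only [Complex.sub_re, Complex.sub_im, Complex.one_re, Complex.one_im]
      linear_combination -this - 2 * hre
    rw [e1]
    have e2 : (1 - r) ^ 2 ≤ t ^ 2 := by gcongr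
    nlinarith [mul_le_mul_of_nonneg_left hcos (by linarith : 0 ≤ 2 * r)]
  have hle : (q / (1 - q)).re ≤ r / (1 - r) / 2 := by
    refine (Complex.re_le_norm _).trans ?_
    rw [norm_div, hqr, div_div, mul_comm]
    gcongr
  have hge : (2 * t)⁻¹ ≤ r / (1 - r) := by
    rw [inv_eq_one_div, div_le_div_iff₀ (by positivity) (by linarith)]
    nlinarith
  have : (4 * t)⁻¹ = (2 * t)⁻¹ / 2 := by ring
  linarith

theorem norm_scaledIntegrand {t : ℝ} (ht : 0 < t) (u : ℝ) :
    ‖scaledIntegrand t u‖ = (√t)⁻¹ * Real.exp (-(π ^ 2 / (3 * t))) * Real.exp (π ^ 2 / (6 * t)) *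
      ‖eulerProduct (Complex.exp (-(t * saddlePoint t u)))‖⁻¹ := by
  rw [scaledIntegrand, norm_mul, norm_mul, Complex.norm_exp, Complex.re_ofReal_mul,
    saddlePoint_re, Complex.norm_real, Real.norm_of_nonneg (by positivity), mul_one, norm_inv]

theorem norm_scaledIntegrand_le_mul_exp {t u : ℝ} (ht : 0 < t) (ht1 : t ≤ 1 / 2)
    (hu : 16 < t * u ^ 2) (h2 : |t * √t * u| ≤ π) :
    ‖scaledIntegrand t u‖ ≤ ‖scaledIntegrand t 0‖ * Real.exp (-(16 * t)⁻¹) := by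
  have hq : Complex.exp (-(t * saddlePoint t u)) =
      Complex.exp (-(t - (t * √t * u : ℝ) * Complex.I)) := by
    congr 1
    rw [saddlePoint]
    push_cast
    ring
  have h1 : 4 * t < |t * √t * u| := by
    refine lt_of_pow_lt_pow_left₀ 2 (abs_nonneg _) ?_
    rw [sq_abs, mul_pow, mul_pow, mul_pow, Real.sq_sqrt ht.le]
    nlinarith [pow_pos ht 2]
  have hg := inv_le_sub_re_div_one_sub_exp ht ht1 h1 h2
  have hn : ‖Complex.exp (-(t - (t * √t * u : ℝ) * Complex.I))‖ = Real.exp (-t) := by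
    rw [Complex.norm_exp]
    simp
  have hlt : Real.exp (-t) < 1 := by simpa using ht
  have hE := norm_eulerProduct_mul_exp_le (hn.trans_lt hlt)
  rw [hn] at hE
  have h0 : Complex.exp (-(t * saddlePoint t 0)) = (Real.exp (-t) : ℝ) := by
    simp [saddlePoint]
  have hp : 0 < ‖eulerProduct (Real.exp (-t) : ℝ)‖ := by
    refine norm_pos_iff.mpr (eulerProduct_ne_zero ?_)
    rwa [Complex.norm_real, Real.norm_of_nonneg (Real.exp_pos _).le]
  rw [norm_scaledIntegrand ht, norm_scaledIntegrand ht, hq, h0, mul_assoc _ _ (Real.exp _),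
    Real.exp_neg (16 * t)⁻¹, mul_assoc _ _ (Real.exp (16 * t)⁻¹)⁻¹,
    ← mul_inv]
  gcongr
  refine le_trans ?_ hE
  gcongr
  calc (16 * t)⁻¹ = (4 * t)⁻¹ / 4 := by ring
    _ ≤ _ := by gcongr

theorem exists_norm_scaledIntegrand_le :
    ∃ B : ℝ, ∀ᶠ t in 𝓝[>] 0, ∀ u : ℝ, |t * √t * u| ≤ π →
      ‖scaledIntegrand t u‖ ≤ B * (1 + u ^ 2)⁻¹ := by
  refine ⟨612 * (6 * 4096 * 11), ?_⟩
  filter_upwards [eventually_norm_scaledIntegrand_le, self_mem_nhdsWithin,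
    nhdsWithin_le_nhds (Iio_mem_nhds (by norm_num : (0 : ℝ) < 1 / 2))] with t hnear ht ht1 u h2
  have ht : 0 < t := ht
  have ht1 : t < 1 / 2 := ht1
  rcases le_or_gt (t * u ^ 2) 16 with hu | hu
  · refine (hnear u hu).trans ?_
    gcongr
    norm_num
  · refine (norm_scaledIntegrand_le_mul_exp ht ht1.le hu h2).trans ?_
    have h0 : ‖scaledIntegrand t 0‖ ≤ 612 := by simpa using hnear 0 (by simp)
    rw [mul_assoc]
    refine mul_le_mul h0 ?_ (Real.exp_pos _).le (by norm_num)
    have e1 : ((16 * t)⁻¹) ^ 3 / 6 ≤ Real.exp (16 * t)⁻¹ :=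
      Real.pow_div_factorial_le_exp _ (by positivity) 3
    have e2 : Real.exp (-(16 * t)⁻¹) ≤ 6 * 4096 * t ^ 3 := by
      rw [Real.exp_neg]
      refine (inv_anti₀ (by positivity) e1).trans_eq ?_
      field_simp
      norm_num
    have e3 : t ^ 3 * u ^ 2 ≤ 10 := by
      have := sq_le_sq' (by linarith [abs_nonneg (t * √t * u), Real.pi_pos]) h2
      rw [sq_abs, mul_pow, mul_pow, Real.sq_sqrt ht.le] at this
      nlinarith [Real.pi_lt_d2, Real.pi_gt_three]
    have e4 : t ^ 3 ≤ 1 := pow_le_one₀ ht.le (by linarith)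
    rw [← div_eq_mul_inv, le_div_iff₀ (by positivity)]
    calc Real.exp (-(16 * t)⁻¹) * (1 + u ^ 2) ≤ 6 * 4096 * t ^ 3 * (1 + u ^ 2) := by gcongr
      _ ≤ _ := by linarith

theorem continuous_scaledIntegrand {t : ℝ} (ht : 0 < t) : Continuous (scaledIntegrand t) := by
  have hw : Continuous (saddlePoint t) := by
    unfold saddlePoint
    fun_prop
  refine (continuous_const.mul (by fun_prop)).mul ?_
  refine differentiableOn_inv_eulerProduct.continuousOn.comp_continuous (by fun_prop) fun u => ?_
  rw [mem_ball_zero_iff, Complex.norm_exp]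
  simpa [saddlePoint_re] using ht

theorem tendsto_integral_scaledIntegrand :
    Tendsto (fun t : ℝ => ∫ u, {u | |t * √t * u| ≤ π}.indicator (scaledIntegrand t) u)
      (𝓝[>] 0) (𝓝 ((√3 / π : ℝ) : ℂ)) := by
  obtain ⟨B, hB⟩ := exists_norm_scaledIntegrand_le
  have hval : ∫ u : ℝ, (((√(2 * π))⁻¹ * Real.exp (-(π ^ 2 / 6) * u ^ 2) : ℝ) : ℂ) =
      ((√3 / π : ℝ) : ℂ) := by
    rw [integral_complex_ofReal, MeasureTheory.integral_const_mul, integral_gaussian]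
    congr 1
    rw [← Real.sqrt_inv, ← Real.sqrt_mul (by positivity)]
    rw [show (2 * π)⁻¹ * (π / (π ^ 2 / 6)) = 3 / π ^ 2 by field_simp; norm_num,
      Real.sqrt_div (by norm_num), Real.sqrt_sq Real.pi_pos.le]
  rw [← hval]
  refine MeasureTheory.tendsto_integral_filter_of_dominated_convergence
    (fun u => |B| * (1 + u ^ 2)⁻¹) ?_ ?_ (integrable_inv_one_add_sq.const_mul _) ?_
  · filter_upwards [self_mem_nhdsWithin] with t ht
    refine (continuous_scaledIntegrand ht).aestronglyMeasurable.indicator ?_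
    exact (isClosed_le (by fun_prop) continuous_const).measurableSet
  · filter_upwards [hB] with t ht
    refine .of_forall fun u => ?_
    by_cases hu : |t * √t * u| ≤ π
    · rw [Set.indicator_of_mem (by exact hu)]
      refine (ht u hu).trans ?_
      gcongr
      exact le_abs_self B
    · rw [Set.indicator_of_notMem (by exact hu), norm_zero]
      positivity
  · refine .of_forall fun u => (tendsto_scaledIntegrand u).congr' ?_
    have hc : Tendsto (fun t : ℝ => |t * √t * u|) (𝓝[>] 0) (𝓝 0) := by
      have : Continuous fun t : ℝ => |t * √t * u| := by fun_prop
      simpa using (this.tendsto 0).mono_left nhdsWithin_le_nhds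
    filter_upwards [hc.eventually (eventually_le_nhds Real.pi_pos)] with t ht
    rw [Set.indicator_of_mem (by exact ht)]

theorem card_partition_eq_integral_scaledIntegrand {n : ℕ} {t : ℝ} (ht : 0 < t)
    (hn : n * t = π ^ 2 / (6 * t)) :
    (Nat.card (Nat.Partition n) : ℂ) = (t ^ 2 / (2 * π) * Real.exp (π ^ 2 / (3 * t)) : ℝ) *
      ∫ u, {u | |t * √t * u| ≤ π}.indicator (scaledIntegrand t) u := by
  have hs : 0 < √t := Real.sqrt_pos.mpr ht
  have hc : 0 < t * √t := by positivity
  have hset : {u : ℝ | |t * √t * u| ≤ π} = Set.Icc (-π / (t * √t)) (π / (t * √t)) := by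
    ext u
    rw [Set.mem_ofPred_eq, abs_le, Set.mem_Icc, div_le_iff₀ hc, le_div_iff₀ hc, mul_comm u]
  rw [hset, MeasureTheory.integral_indicator measurableSet_Icc,
    MeasureTheory.integral_Icc_eq_integral_Ioc, ← intervalIntegral.integral_of_le (by
      gcongr; linarith [Real.pi_pos]), card_partition_eq_integral n ht]
  have hsub := intervalIntegral.integral_comp_mul_left (a := -π / (t * √t)) (b := π / (t * √t))
    (fun θ : ℝ => Complex.exp (n * (t - θ * Complex.I)) *
        (eulerProduct (Complex.exp (-(t - θ * Complex.I))))⁻¹) hc.ne'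
  rw [mul_div_cancel₀ _ hc.ne', mul_div_cancel₀ _ hc.ne'] at hsub
  have hint : ∀ u : ℝ, scaledIntegrand t u = ((√t)⁻¹ * Real.exp (-(π ^ 2 / (3 * t))) : ℝ) *
      (Complex.exp (n * (t - (t * √t * u : ℝ) * Complex.I)) *
        (eulerProduct (Complex.exp (-(t - (t * √t * u : ℝ) * Complex.I))))⁻¹) := fun u => by
    have e : (t : ℂ) - (t * √t * u : ℝ) * Complex.I = t * saddlePoint t u := by
      rw [saddlePoint]
      push_cast
      ring
    rw [e, ← mul_assoc, ← mul_assoc (n : ℂ), scaledIntegrand, ← hn]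
    push_cast
    rfl
  simp only [hint]
  rw [intervalIntegral.integral_const_mul, hsub, Complex.real_smul, ← mul_assoc, ← mul_assoc]
  congr 1
  norm_cast
  rw [Real.exp_neg]
  have := Real.exp_ne_zero (π ^ 2 / (3 * t))
  field_simp
  exact Real.sq_sqrt ht.le

theorem hardy_ramanujan :
    Tendsto (fun n : ℕ =>
        (Nat.card (Nat.Partition n) : ℝ) /
          (Real.exp (π * Real.sqrt (2 * n / 3)) / (4 * Real.sqrt 3 * n)))
      atTop (𝓝 1) := by
  have ht : Tendsto (fun n : ℕ => π / √(6 * n)) atTop (𝓝[>] 0) := by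
    refine tendsto_nhdsWithin_iff.mpr ⟨tendsto_const_nhds.div_atTop ?_, ?_⟩
    · exact Real.tendsto_sqrt_atTop.comp
        (tendsto_natCast_atTop_atTop.const_mul_atTop (by norm_num))
    · filter_upwards [eventually_gt_atTop 0] with n hn
      have : (0 : ℝ) < n := mod_cast hn
      exact div_pos Real.pi_pos (Real.sqrt_pos.mpr (by positivity))
  have h := (tendsto_integral_scaledIntegrand.comp ht).const_mul ((π / √3 : ℝ) : ℂ)
  have h1 : ((π / √3 : ℝ) : ℂ) * ((√3 / π : ℝ) : ℂ) = ((1 : ℝ) : ℂ) := by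
    rw [← Complex.ofReal_mul]
    congr 1
    field_simp
  rw [h1] at h
  have hre := (Complex.continuous_re.tendsto _).comp h
  rw [Complex.ofReal_re] at hre
  refine hre.congr' ?_
  filter_upwards [eventually_gt_atTop 0] with n hn
  have hn0 : (0 : ℝ) < n := mod_cast hn
  have hsq : √(6 * n) ^ 2 = 6 * (n : ℝ) := Real.sq_sqrt (by positivity)
  have hs : 0 < √(6 * (n : ℝ)) := Real.sqrt_pos.mpr (by positivity)
  have hsaddle : n * (π / √(6 * n)) = π ^ 2 / (6 * (π / √(6 * n))) := by
    generalize √(6 * (n : ℝ)) = s at hsq hs ⊢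
    field_simp
    linarith
  have hcard := card_partition_eq_integral_scaledIntegrand (div_pos Real.pi_pos hs) hsaddle
  have hexp : π ^ 2 / (3 * (π / √(6 * n))) = π * √(2 * n / 3) := by
    have : √(2 * n / 3) = √(6 * n) / 3 := by
      rw [show (2 * n / 3 : ℝ) = 6 * n / 3 ^ 2 by ring, Real.sqrt_div' _ (by norm_num),
        Real.sqrt_sq (by norm_num)]
    rw [this]
    field_simp
  rw [hexp] at hcard
  have hcard' := congrArg Complex.re hcard
  rw [Complex.natCast_re, Complex.re_ofReal_mul] at hcard'
  rw [hcard', Function.comp_apply, Function.comp_apply, Complex.re_ofReal_mul, div_pow, hsq]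
  have h3 : √3 ^ 2 = (3 : ℝ) := Real.sq_sqrt (by norm_num)
  field_simp
  rw [h3]
  ring
end
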